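/- arXiv:2004.04556 — 5 statements merged into one kernel-verified Lean document; each statement's English description precedes it below -/
import Mathlib

section
/- ∑_{n=1}^∞ (-1)^{n-1}·h_n/n² = 2πG - (7/2)·ζ(3), where h_n = ∑_{k=1}^n 1/(k-1/2) and G is Catalan's constant. -/
open scoped BigOperators

/-- ζ(p) = ∑_{n=1}^∞ 1/n^p -/
noncomputable def zetaR (p : ℕ) : ℝ := ∑' n : ℕ, 1 / ((n : ℝ) + 1) ^ p

/-- Odd harmonic number h_n^{(p)} = ∑_{k=1}^n 1/(k−1/2)^p -/
noncomputable def oddH (p n : ℕ) : ℝ := ∑ k ∈ Finset.range n, 1 / ((k : ℝ) + 1 / 2) ^ p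

/-- Alternating odd harmonic number h̄_n^{(p)} = ∑_{k=1}^n (−1)^{k−1}/(k−1/2)^p -/
noncomputable def altOddH (p n : ℕ) : ℝ :=
  ∑ k ∈ Finset.range n, (-1 : ℝ) ^ k / ((k : ℝ) + 1 / 2) ^ p

/-- Dirichlet beta β(s) = ∑_{n=0}^∞ (−1)^n/(2n+1)^s -/
noncomputable def betaD (s : ℕ) : ℝ := ∑' n : ℕ, (-1 : ℝ) ^ n / (2 * (n : ℝ) + 1) ^ s

noncomputable def ha (n : ℕ) : ℝ := (n : ℝ) + 1 / 2

lemma ha_pos (n : ℕ) : 0 < ha n := by unfold ha; positivity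

lemma hasSum_antidiag (F : ℕ × ℕ → ℝ) (hF : Summable F) :
    HasSum (fun n => ∑ p ∈ Finset.HasAntidiagonal.antidiagonal n, F p) (∑' p, F p) := by
  have h := (Finset.HasAntidiagonal.sigmaAntidiagonalEquivProd (A := ℕ)).hasSum_iff.2 hF.hasSum
  refine h.sigma (fun n => ?_)
  have h2 := hasSum_fintype (fun c : Finset.HasAntidiagonal.antidiagonal n => F c.1)
  rw [Finset.sum_coe_sort (Finset.HasAntidiagonal.antidiagonal n) F] at h2
  exact h2

noncomputable def gg (p : ℕ × ℕ) : ℝ :=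
  (-1) ^ (p.1 + p.2 + 1) / (((p.1 : ℝ) + p.2 + 1) * ha p.1 * ha p.2)

/-- p = (n, j) -/
noncomputable def ff (p : ℕ × ℕ) : ℝ :=
  (-1) ^ (p.2 + 1) / (((p.2 : ℝ) + 1) * ha p.1 * ha (p.1 + p.2 + 1))

lemma summable_u : Summable (fun n : ℕ => 1 / (√(ha n)) ^ 3) := by
  have h := (Real.summable_one_div_nat_add_rpow (1/2) (3/2)).2 (by norm_num)
  refine h.congr (fun n => ?_)
  have := ha_pos n
  rw [show ((n : ℝ) + 1/2) = ha n from rfl, abs_of_pos this, Real.sqrt_eq_rpow,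
    ← Real.rpow_natCast, ← Real.rpow_mul this.le]
  norm_num

lemma key_ineq {x y : ℝ} (hx : 0 < x) (hy : 0 < y) :
    1 / ((x + y) * x * y) ≤ (1 / √x ^ 3) * (1 / √y ^ 3) := by
  have hs := Real.sqrt_pos.2 hx
  have ht := Real.sqrt_pos.2 hy
  rw [one_div_mul_one_div_rev]
  have e1 := Real.sq_sqrt hx.le
  have e2 := Real.sq_sqrt hy.le
  generalize √x = s at *
  generalize √y = t at *
  subst e1 e2
  apply one_div_le_one_div_of_le (by positivity)
  have : 0 < s ^ 2 * t ^ 2 := by positivity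
  nlinarith [sq_nonneg (s - t), mul_pos hs ht]

lemma summable_bd : Summable (fun p : ℕ × ℕ => (1 / √(ha p.1) ^ 3) * (1 / √(ha p.2) ^ 3)) :=
  summable_u.mul_of_nonneg summable_u (fun n => by positivity) (fun n => by positivity)

lemma summable_gg : Summable gg := by
  refine Summable.of_norm_bounded summable_bd (fun p => ?_)
  have h1 := ha_pos p.1
  have h2 := ha_pos p.2
  refine le_trans (le_of_eq ?_) (key_ineq h1 h2)
  unfold gg
  rw [norm_div, norm_pow, norm_neg, norm_one, one_pow, Real.norm_of_nonneg (by positivity)]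
  congr 3
  unfold ha; ring

lemma summable_ff : Summable ff := by
  refine Summable.of_norm_bounded summable_bd (fun p => ?_)
  have h1 := ha_pos p.1
  have h2 := ha_pos p.2
  have h3 := ha_pos (p.1 + p.2 + 1)
  refine le_trans ?_ (key_ineq h1 h2)
  unfold ff
  rw [norm_div, norm_pow, norm_neg, norm_one, one_pow, Real.norm_of_nonneg (by positivity)]
  apply one_div_le_one_div_of_le (by positivity)
  have e1 : ha p.1 + ha p.2 ≤ ha (p.1 + p.2 + 1) := by unfold ha; push_cast; linarith
  have e2 : ha p.2 ≤ (p.2 : ℝ) + 1 := by unfold ha; linarith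
  calc (ha p.1 + ha p.2) * ha p.1 * ha p.2 = ha p.2 * ha p.1 * (ha p.1 + ha p.2) := by ring
    _ ≤ _ := by gcongr

lemma gg_anti (n : ℕ) : ∑ p ∈ Finset.HasAntidiagonal.antidiagonal n, gg p =
    -2 * ((-1 : ℝ) ^ n * oddH 1 (n + 1) / ((n : ℝ) + 1) ^ 2) := by
  have h : ∀ p ∈ Finset.HasAntidiagonal.antidiagonal n, gg p =
      (-1) ^ (n + 1) / ((n : ℝ) + 1) ^ 2 * (1 / ha p.1) +
      (-1) ^ (n + 1) / ((n : ℝ) + 1) ^ 2 * (1 / ha p.2) := by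
    intro p hp
    have hp := Finset.HasAntidiagonal.mem_antidiagonal.1 hp
    have h1 := ha_pos p.1
    have h2 := ha_pos p.2
    have hn : (n : ℝ) + 1 = ha p.1 + ha p.2 := by
      rw [← hp]; unfold ha; push_cast; ring
    unfold gg
    rw [hp, show (p.1 : ℝ) + p.2 + 1 = ha p.1 + ha p.2 by unfold ha; ring, hn]
    field_simp
    ring
  rw [Finset.sum_congr rfl h, Finset.sum_add_distrib, ← Finset.mul_sum, ← Finset.mul_sum]
  have e1 : ∑ p ∈ Finset.HasAntidiagonal.antidiagonal n, 1 / ha p.1 = oddH 1 (n + 1) := by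
    rw [Finset.Nat.sum_antidiagonal_eq_sum_range_succ (fun i _ => 1 / ha i)]
    simp [oddH, ha]
  have e2 : ∑ p ∈ Finset.HasAntidiagonal.antidiagonal n, 1 / ha p.2 = oddH 1 (n + 1) := by
    rw [← e1, ← Finset.Nat.sum_antidiagonal_swap]
    rfl
  rw [e1, e2]
  ring

lemma hasSum_gg : ∑' p, gg p =
    -2 * ∑' n : ℕ, (-1 : ℝ) ^ n * oddH 1 (n + 1) / ((n : ℝ) + 1) ^ 2 := by
  rw [← tsum_mul_left, ← (hasSum_antidiag gg summable_gg).tsum_eq]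
  exact tsum_congr gg_anti

noncomputable def LL (j : ℕ) : ℝ :=
  ∑ m ∈ Finset.range j, (-1 : ℝ) ^ (j - m) / (((j : ℝ) - m) * ha m * ha j)

lemma hasSum_LL : HasSum LL (∑' p, ff p) := by
  have h := hasSum_antidiag ff summable_ff
  have h2 : (fun n => ∑ p ∈ Finset.HasAntidiagonal.antidiagonal n, ff p) = fun n => LL (n + 1) := by
    funext n
    rw [Finset.Nat.sum_antidiagonal_eq_sum_range_succ_mk]
    unfold LL
    refine Finset.sum_congr rfl (fun k hk => ?_)
    have hk : k ≤ n := by simpa [Nat.lt_succ_iff] using hk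
    unfold ff
    simp only
    rw [show k + (n - k) + 1 = n + 1 by omega, show n + 1 - k = n - k + 1 by omega]
    push_cast [Nat.cast_sub hk]
    ring
  rw [h2] at h
  have := (hasSum_nat_add_iff 1).1 h
  simpa [LL] using this

open Filter Topology

lemma tendsto_P : Tendsto (fun N => ∑ i ∈ Finset.range N, (-1 : ℝ) ^ i / ha i) atTop
    (𝓝 (Real.pi / 2)) := by
  have h := Real.tendsto_sum_pi_div_four.const_mul 2
  rw [show Real.pi / 2 = 2 * (Real.pi / 4) by ring]
  refine h.congr (fun N => ?_)
  rw [Finset.mul_sum]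
  refine Finset.sum_congr rfl (fun i _ => ?_)
  unfold ha
  field_simp

lemma exists_A : ∃ A : ℝ, Tendsto (fun N : ℕ => ∑ i ∈ Finset.range N, (-1 : ℝ) ^ i / ((i : ℝ) + 1))
    atTop (𝓝 A) := by
  have h := Antitone.tendsto_alternating_series_of_tendsto_zero
    (f := fun n : ℕ => 1 / ((n : ℝ) + 1)) (fun a b hab => by simp only; gcongr)
    tendsto_one_div_add_atTop_nhds_zero_nat
  simpa [div_eq_mul_inv] using h

lemma tendsto_U (j : ℕ) {A : ℝ}
    (hA : Tendsto (fun N : ℕ => ∑ i ∈ Finset.range N, (-1 : ℝ) ^ i / ((i : ℝ) + 1)) atTop (𝓝 A)) :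
    Tendsto (fun N => ∑ n ∈ Finset.range N, ha j ^ 2 * ff (j, n)) atTop
      (𝓝 (-A - (-1) ^ j * (Real.pi / 2 - ∑ i ∈ Finset.range (j + 1), (-1 : ℝ) ^ i / ha i))) := by
  have h1 := (tendsto_P.comp (tendsto_add_atTop_nat (j + 1))).sub_const
    (∑ i ∈ Finset.range (j + 1), (-1 : ℝ) ^ i / ha i)
  refine (hA.neg.sub (h1.const_mul ((-1) ^ j))).congr (fun N => ?_)
  simp only [Function.comp]
  rw [add_comm N, Finset.sum_range_add, add_sub_cancel_left, Finset.mul_sum, ← Finset.sum_neg_distrib,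
    ← Finset.sum_sub_distrib]
  refine Finset.sum_congr rfl (fun n _ => ?_)
  have h1 := ha_pos j
  have h2 := ha_pos (j + n + 1)
  have h3 : ha (j + n + 1) = ha j + (n + 1) := by unfold ha; push_cast; ring
  unfold ff
  simp only
  rw [show j + 1 + n = j + n + 1 by ring, h3]
  have hs : ((-1 : ℝ) ^ j) * (-1) ^ j = 1 := by rw [← mul_pow]; simp
  have : (-1 : ℝ) ^ j * ((-1) ^ (j + n + 1) / (ha j + (n + 1))) =
      (-1) ^ (n + 1) / (ha j + (n + 1)) := by
    rw [← mul_div_assoc, add_assoc, pow_add, ← mul_assoc, hs, one_mul]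
  rw [this]
  field_simp
  ring

lemma tendsto_N (j : ℕ) {A : ℝ}
    (hA : Tendsto (fun N : ℕ => ∑ i ∈ Finset.range N, (-1 : ℝ) ^ i / ((i : ℝ) + 1)) atTop (𝓝 A)) :
    Tendsto (fun N => ∑ i ∈ Finset.range N, ha j ^ 2 * gg (j, i)) atTop
      (𝓝 ((A - ∑ i ∈ Finset.range j, (-1 : ℝ) ^ i / ((i : ℝ) + 1)) - (-1) ^ j * (Real.pi / 2))) := by
  have h1 := (hA.comp (tendsto_add_atTop_nat j)).sub_const
    (∑ i ∈ Finset.range j, (-1 : ℝ) ^ i / ((i : ℝ) + 1))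
  refine (h1.sub (tendsto_P.const_mul ((-1) ^ j))).congr (fun N => ?_)
  simp only [Function.comp]
  rw [add_comm N, Finset.sum_range_add, add_sub_cancel_left, Finset.mul_sum,
    ← Finset.sum_sub_distrib]
  refine Finset.sum_congr rfl (fun n _ => ?_)
  have h1 := ha_pos j
  have h2 := ha_pos n
  unfold gg
  simp only
  push_cast
  rw [show (j : ℝ) + n + 1 = ha j + ha n by unfold ha; ring, pow_succ, pow_add]
  field_simp
  ring

lemma LL_eq (j : ℕ) : ha j ^ 2 * LL j =
    (-1) ^ j * ∑ i ∈ Finset.range j, (-1 : ℝ) ^ i / ha i -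
      ∑ i ∈ Finset.range j, (-1 : ℝ) ^ i / ((i : ℝ) + 1) := by
  rw [← Finset.sum_range_reflect (fun i : ℕ => (-1 : ℝ) ^ i / ((i : ℝ) + 1)), Finset.mul_sum,
    ← Finset.sum_sub_distrib]
  unfold LL
  rw [Finset.mul_sum]
  refine Finset.sum_congr rfl (fun m hm => ?_)
  have hm := Finset.mem_range.1 hm
  obtain ⟨k, rfl⟩ : ∃ k, j = m + k + 1 := ⟨j - m - 1, by omega⟩
  rw [show m + k + 1 - m = k + 1 by omega, show m + k + 1 - 1 - m = k by omega]
  have h2 := ha_pos m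
  have h3 : ha (m + k + 1) = ha m + (k + 1) := by unfold ha; push_cast; ring
  have hs : ((-1 : ℝ) ^ m) * (-1) ^ m = 1 := by rw [← mul_pow]; simp
  have : (-1 : ℝ) ^ (m + k + 1) * ((-1) ^ m / ha m) = (-1) ^ (k + 1) / ha m := by
    rw [← mul_div_assoc, add_assoc, pow_add, mul_right_comm, hs, one_mul]
  rw [this, h3]
  push_cast
  rw [show (m : ℝ) + k + 1 - m = k + 1 by ring]
  field_simp
  ring

lemma row (j : ℕ) : (∑' n, ff (j, n)) - LL j + ∑' i, gg (j, i) =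
    1 / ha j ^ 3 - Real.pi * ((-1) ^ j / ha j ^ 2) := by
  obtain ⟨A, hA⟩ := exists_A
  have hj := ha_pos j
  have s1 := ((summable_ff.prod_factor j).mul_left (ha j ^ 2)).hasSum.tendsto_sum_nat
  have s2 := ((summable_gg.prod_factor j).mul_left (ha j ^ 2)).hasSum.tendsto_sum_nat
  have e1 := tendsto_nhds_unique s1 (tendsto_U j hA)
  have e2 := tendsto_nhds_unique s2 (tendsto_N j hA)
  rw [tsum_mul_left] at e1 e2
  have e3 := LL_eq j
  have hs : ((-1 : ℝ) ^ j) * (-1) ^ j = 1 := by rw [← mul_pow]; simp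
  have h : ha j ^ 2 * ((∑' n, ff (j, n)) - LL j + ∑' i, gg (j, i)) =
      1 / ha j - Real.pi * (-1) ^ j := by
    rw [mul_add, mul_sub, e1, e2, e3, Finset.sum_range_succ]
    have : (-1 : ℝ) ^ j * ((-1) ^ j / ha j) = 1 / ha j := by rw [← mul_div_assoc, hs]
    linear_combination this
  have h' : (∑' n, ff (j, n)) - LL j + ∑' i, gg (j, i) =
      (1 / ha j - Real.pi * (-1) ^ j) / ha j ^ 2 := by
    rw [← h]; field_simp
  rw [h']
  field_simp

lemma summable_cube : Summable (fun n : ℕ => 1 / ((n : ℝ) + 1) ^ 3) := by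
  have := (summable_nat_add_iff 1).2 (Real.summable_one_div_nat_pow.2 (show 1 < 3 by norm_num))
  simpa using this

lemma summable_ha {p : ℕ} (hp : 1 < p) : Summable (fun n : ℕ => 1 / (ha n) ^ p) := by
  have h := (Real.summable_one_div_nat_add_rpow (1/2) p).2 (by exact_mod_cast hp)
  refine h.congr (fun n => ?_)
  have := ha_pos n
  rw [show ((n : ℝ) + 1/2) = ha n from rfl, abs_of_pos this, Real.rpow_natCast]

lemma sum_cube : ∑' j, 1 / ha j ^ 3 = 7 * zetaR 3 := by
  have e : ∀ k : ℕ, 1 / (((2 * k : ℕ) : ℝ) + 1) ^ 3 = 1 / 8 * (1 / ha k ^ 3) := by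
    intro k
    rw [show (((2 * k : ℕ) : ℝ) + 1) = 2 * ha k by unfold ha; push_cast; ring]
    have := ha_pos k
    field_simp
    norm_num
  have o : ∀ k : ℕ, 1 / (((2 * k + 1 : ℕ) : ℝ) + 1) ^ 3 = 1 / 8 * (1 / ((k : ℝ) + 1) ^ 3) := by
    intro k
    rw [show (((2 * k + 1 : ℕ) : ℝ) + 1) = 2 * ((k : ℝ) + 1) by push_cast; ring]
    field_simp
    norm_num
  have h := tsum_even_add_odd (f := fun n : ℕ => 1 / ((n : ℝ) + 1) ^ 3)
    (by simp only [e]; exact (summable_ha (by norm_num)).mul_left _)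
    (by simp only [o]; exact summable_cube.mul_left _)
  simp only [e, o] at h
  rw [tsum_mul_left, tsum_mul_left] at h
  unfold zetaR
  linarith

lemma sum_beta : ∑' j, (-1 : ℝ) ^ j / ha j ^ 2 = 4 * betaD 2 := by
  unfold betaD
  rw [← tsum_mul_left]
  refine tsum_congr (fun j => ?_)
  rw [show (2 * (j : ℝ) + 1) = 2 * ha j by unfold ha; ring]
  have := ha_pos j
  field_simp
  norm_num

lemma summable_beta : Summable (fun j => (-1 : ℝ) ^ j / ha j ^ 2) := by
  refine Summable.of_norm_bounded (summable_ha (p := 2) (by norm_num)) (fun j => ?_)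
  have := ha_pos j
  rw [norm_div, norm_pow, norm_neg, norm_one, one_pow, Real.norm_of_nonneg (by positivity)]

/-- ∑_{n=1}^∞ (−1)^{n−1} h_n/n² = 2πG − (7/2)ζ(3) -/
theorem alt_linear_sum_12 :
    (∑' n : ℕ, (-1 : ℝ) ^ n * oddH 1 (n + 1) / ((n : ℝ) + 1) ^ 2) =
      2 * Real.pi * betaD 2 - 7 / 2 * zetaR 3 := by
  have h1 := (summable_ff.hasSum.prod_fiberwise (fun j => (summable_ff.prod_factor j).hasSum))
  have h2 := (summable_gg.hasSum.prod_fiberwise (fun j => (summable_gg.prod_factor j).hasSum))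
  have h := (h1.sub hasSum_LL).add h2
  simp only [row] at h
  have h' := ((summable_ha (p := 3) (by norm_num)).hasSum.sub (summable_beta.hasSum.mul_left Real.pi))
  have e := h.unique h'
  rw [hasSum_gg, sum_cube, sum_beta] at e
  linarith
end

section
/- ∑_{n=1}^∞ h̄_n/n³ = (7π/2)·ζ(3) - (π²/3)·G - 8·β(4), where h̄_n = ∑_{k=1}^n (-1)^{k-1}/(k-1/2), G is Catalan's constant, and β is the Dirichlet beta function. -/
open scoped BigOperators

open MeasureTheory Filter Topology Set

lemma aux_dirichlet_cos (n : ℕ) (x : ℝ) :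
    (∑ k ∈ Finset.range n, 2 * Real.cos ((2 * (k : ℝ) + 1) * x)) * Real.sin x
      = Real.sin (2 * n * x) := by
  induction n with
  | zero => simp
  | succ n ih =>
    rw [Finset.sum_range_succ, add_mul, ih]
    have h1 : 2 * (((n + 1 : ℕ) : ℝ)) * x = (2 * (n : ℝ) + 1) * x + x := by push_cast; ring
    have h2 : 2 * (n : ℝ) * x = (2 * (n : ℝ) + 1) * x - x := by ring
    rw [h1, h2, Real.sin_add, Real.sin_sub]
    ring

lemma aux_dirichlet_sin (n : ℕ) (x : ℝ) :
    (∑ k ∈ Finset.range n, 2 * Real.sin ((2 * (k : ℝ) + 1) * x)) * Real.sin x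
      = 1 - Real.cos (2 * n * x) := by
  induction n with
  | zero => simp
  | succ n ih =>
    rw [Finset.sum_range_succ, add_mul, ih]
    have h1 : 2 * (((n + 1 : ℕ) : ℝ)) * x = (2 * (n : ℝ) + 1) * x + x := by push_cast; ring
    have h2 : 2 * (n : ℝ) * x = (2 * (n : ℝ) + 1) * x - x := by ring
    rw [h1, h2, Real.cos_add, Real.cos_sub]
    ring

lemma aux_sin_half (k : ℕ) : Real.sin ((2 * (k : ℝ) + 1) * (Real.pi / 2)) = (-1) ^ k := by
  have : (2 * (k : ℝ) + 1) * (Real.pi / 2) = Real.pi / 2 + k * Real.pi := by ring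
  rw [this, Real.sin_add_nat_mul_pi, Real.sin_pi_div_two, mul_one]

lemma aux_cos_half (k : ℕ) : Real.cos ((2 * (k : ℝ) + 1) * (Real.pi / 2)) = 0 := by
  have : (2 * (k : ℝ) + 1) * (Real.pi / 2) = Real.pi / 2 + k * Real.pi := by ring
  rw [this, Real.cos_add_nat_mul_pi, Real.cos_pi_div_two, mul_zero]

/-- The summands, as continuous functions. -/
noncomputable def auxf (n : ℕ) (x : ℝ) : ℝ :=
  (∑ k ∈ Finset.range (n + 1), 2 * Real.cos ((2 * (k : ℝ) + 1) * x)) / ((n : ℝ) + 1) ^ 3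

lemma auxf_cont (n : ℕ) : Continuous (auxf n) := by
  unfold auxf; fun_prop

lemma auxf_bound (n : ℕ) (x : ℝ) : ‖auxf n x‖ ≤ 2 * (1 / ((n : ℝ) + 1) ^ 2) := by
  unfold auxf
  have hp : (0 : ℝ) < (n : ℝ) + 1 := by positivity
  rw [norm_div, Real.norm_of_nonneg (by positivity : (0 : ℝ) ≤ ((n : ℝ) + 1) ^ 3),
    div_le_iff₀ (by positivity)]
  have h : ‖∑ k ∈ Finset.range (n + 1), 2 * Real.cos ((2 * (k : ℝ) + 1) * x)‖
      ≤ ∑ k ∈ Finset.range (n + 1), (2 : ℝ) := by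
    refine norm_sum_le_of_le _ fun k _ => ?_
    rw [norm_mul, Real.norm_eq_abs, Real.norm_eq_abs, abs_two]
    have := Real.abs_cos_le_one ((2 * (k : ℝ) + 1) * x)
    linarith
  refine h.trans (le_of_eq ?_)
  simp
  field_simp

lemma aux_summ (p : ℕ) (hp : 1 < p) : Summable (fun n : ℕ => 1 / ((n : ℝ) + 1) ^ p) := by
  have := (summable_nat_add_iff 1).2 (Real.summable_one_div_nat_pow.2 hp)
  simpa using this

lemma auxf_integral (n : ℕ) :
    ∫ x in (0 : ℝ)..(Real.pi / 2), auxf n x = altOddH 1 (n + 1) / ((n : ℝ) + 1) ^ 3 := by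
  unfold auxf altOddH
  rw [intervalIntegral.integral_div, intervalIntegral.integral_finsetSum]
  · congr 1
    refine Finset.sum_congr rfl fun k _ => ?_
    have hk : (2 * (k : ℝ) + 1) ≠ 0 := by positivity
    rw [intervalIntegral.integral_const_mul, intervalIntegral.integral_comp_mul_left _ hk,
      integral_cos, aux_sin_half]
    simp
    have hk' : ((k : ℝ) + 2⁻¹) ≠ 0 := by positivity
    field_simp
  · intro k _
    exact Continuous.intervalIntegrable (by fun_prop) _ _

noncomputable def auxF (x : ℝ) : ℝ := ∑' n, auxf n x

lemma auxF_cont : Continuous auxF :=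
  continuous_tsum auxf_cont ((aux_summ 2 (by norm_num)).mul_left 2) auxf_bound

lemma auxF_integral : ∫ x in (0 : ℝ)..(Real.pi / 2), auxF x
    = ∑' n : ℕ, altOddH 1 (n + 1) / ((n : ℝ) + 1) ^ 3 := by
  have := intervalIntegral.hasSum_integral_of_dominated_convergence
    (μ := volume) (a := 0) (b := Real.pi / 2) (F := auxf) (f := auxF)
    (fun n _ => 2 * (1 / ((n : ℝ) + 1) ^ 2))
    (fun n => (auxf_cont n).aestronglyMeasurable)
    (fun n => Eventually.of_forall fun x _ => auxf_bound n x)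
    (Eventually.of_forall fun x _ => (aux_summ 2 (by norm_num)).mul_left 2)
    (by simp)
    (Eventually.of_forall fun x _ =>
      (Summable.of_norm_bounded ((aux_summ 2 (by norm_num)).mul_left 2)
        (fun n => auxf_bound n x)).hasSum)
  simp_rw [auxf_integral] at this
  exact this.tsum_eq.symm

noncomputable def auxP (x : ℝ) : ℝ :=
  Real.pi ^ 2 * x / 3 - Real.pi * x ^ 2 + 2 * x ^ 3 / 3

lemma aux_bern (x : ℝ) :
    (Polynomial.map (algebraMap ℚ ℝ) (Polynomial.bernoulli (2 * 1 + 1))).eval x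
      = x ^ 3 - 3 / 2 * x ^ 2 + 1 / 2 * x := by
  have h3 : bernoulli 3 = 0 := by
    rw [bernoulli_eq_bernoulli'_of_ne_one (by decide : 3 ≠ 1), bernoulli'_three]
  have h2 : bernoulli 2 = 1 / 6 := by
    rw [bernoulli_eq_bernoulli'_of_ne_one (by decide : 2 ≠ 1), bernoulli'_two]
  simp [Polynomial.bernoulli_def, Finset.sum_range_succ, h3, h2, bernoulli_one]
  norm_num [Nat.choose]
  ring

lemma auxF_mul_sin {x : ℝ} (hx : x ∈ Icc 0 (Real.pi / 2)) : auxF x * Real.sin x = auxP x := by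
  have hpi := Real.pi_pos
  have hx' : x / Real.pi ∈ Icc (0 : ℝ) 1 := by
    refine ⟨div_nonneg hx.1 hpi.le, ?_⟩
    rw [div_le_one hpi]
    linarith [hx.2]
  have h := hasSum_one_div_nat_pow_mul_sin (k := 1) one_ne_zero hx'
  rw [aux_bern, ← hasSum_nat_add_iff' 1] at h
  have e : ∀ n : ℕ, auxf n x * Real.sin x = 1 / ((n + 1 : ℕ) : ℝ) ^ (2 * 1 + 1) *
      Real.sin (2 * Real.pi * ((n + 1 : ℕ) : ℝ) * (x / Real.pi)) := by
    intro n
    unfold auxf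
    rw [div_mul_eq_mul_div, aux_dirichlet_cos]
    have : 2 * Real.pi * ((n + 1 : ℕ) : ℝ) * (x / Real.pi) = 2 * ((n + 1 : ℕ) : ℝ) * x := by
      field_simp
    rw [this]
    push_cast
    ring
  unfold auxF
  rw [← tsum_mul_right, tsum_congr e, h.tsum_eq]
  unfold auxP
  simp [Nat.factorial]
  field_simp
  ring

lemma aux_moment (k : ℕ) : ∫ x in (0 : ℝ)..(Real.pi / 2),
      2 * Real.sin ((2 * (k : ℝ) + 1) * x) * auxP x
    = 4 * Real.pi * (1 / (2 * (k : ℝ) + 1) ^ 3)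
      - Real.pi ^ 2 / 3 * ((-1) ^ k / (2 * (k : ℝ) + 1) ^ 2)
      - 8 * ((-1) ^ k / (2 * (k : ℝ) + 1) ^ 4) := by
  have hm : (2 * (k : ℝ) + 1) ≠ 0 := by positivity
  have hs := aux_sin_half k
  have hc := aux_cos_half k
  set m : ℝ := 2 * (k : ℝ) + 1 with hmdef
  have hd : ∀ x ∈ uIcc (0 : ℝ) (Real.pi / 2), HasDerivAt (fun x : ℝ =>
      2 * (-(auxP x * Real.cos (m * x)) / m
        + (Real.pi ^ 2 / 3 - 2 * Real.pi * x + 2 * x ^ 2) * Real.sin (m * x) / m ^ 2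
        + (-(2 * Real.pi) + 4 * x) * Real.cos (m * x) / m ^ 3
        - 4 * Real.sin (m * x) / m ^ 4))
      (2 * Real.sin (m * x) * auxP x) x := by
    intro x _
    have hmx : HasDerivAt (fun x : ℝ => m * x) m x := by
      simpa using (hasDerivAt_id x).const_mul m
    have hS := hmx.sin
    have hC := hmx.cos
    have hP : HasDerivAt auxP (Real.pi ^ 2 / 3 - 2 * Real.pi * x + 2 * x ^ 2) x := by
      unfold auxP
      have := ((((hasDerivAt_id x).const_mul (Real.pi ^ 2)).div_const 3).sub
        ((hasDerivAt_pow 2 x).const_mul Real.pi)).add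
        (((hasDerivAt_pow 3 x).const_mul 2).div_const 3)
      refine this.congr_deriv ?_
      simp
      ring
    have hQ : HasDerivAt (fun x : ℝ => Real.pi ^ 2 / 3 - 2 * Real.pi * x + 2 * x ^ 2)
        (-(2 * Real.pi) + 4 * x) x := by
      have := (((hasDerivAt_id x).const_mul (2 * Real.pi)).const_sub (Real.pi ^ 2 / 3)).add
        ((hasDerivAt_pow 2 x).const_mul 2)
      refine this.congr_deriv ?_
      simp
      ring
    have hR : HasDerivAt (fun x : ℝ => -(2 * Real.pi) + 4 * x) 4 x := by
      simpa using ((hasDerivAt_id x).const_mul 4).const_add (-(2 * Real.pi))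
    have := ((((hP.mul hC).neg.div_const m).add ((hQ.mul hS).div_const (m ^ 2))).add
      ((hR.mul hC).div_const (m ^ 3))).sub ((hS.const_mul 4).div_const (m ^ 4))
    refine (this.const_mul 2).congr_deriv ?_
    field_simp
    ring
  rw [intervalIntegral.integral_eq_sub_of_hasDerivAt hd]
  · rw [hs, hc]
    simp [auxP]
    field_simp
    ring
  · refine Continuous.intervalIntegrable ?_ _ _
    unfold auxP
    fun_prop

lemma aux_partial (N : ℕ) :
    ∑ k ∈ Finset.range N, (4 * Real.pi * (1 / (2 * (k : ℝ) + 1) ^ 3)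
      - Real.pi ^ 2 / 3 * ((-1) ^ k / (2 * (k : ℝ) + 1) ^ 2)
      - 8 * ((-1) ^ k / (2 * (k : ℝ) + 1) ^ 4))
    = (∫ x in (0 : ℝ)..(Real.pi / 2), auxF x)
      - ∫ x in (0 : ℝ)..(Real.pi / 2), Real.cos (2 * N * x) * auxF x := by
  have hF := auxF_cont
  rw [← intervalIntegral.integral_sub (hF.intervalIntegrable _ _)
    (Continuous.intervalIntegrable (by fun_prop) _ _)]
  simp_rw [← aux_moment]
  rw [← intervalIntegral.integral_finsetSum]
  · refine intervalIntegral.integral_congr fun x hx => ?_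
    rw [uIcc_of_le (by positivity)] at hx
    rw [← Finset.sum_mul, ← auxF_mul_sin hx, mul_left_comm, aux_dirichlet_sin]
    ring
  · intro k _
    refine Continuous.intervalIntegrable ?_ _ _
    unfold auxP
    fun_prop

lemma aux_RL : Tendsto (fun N : ℕ =>
    ∫ x in (0 : ℝ)..(Real.pi / 2), Real.cos (2 * N * x) * auxF x) atTop (𝓝 0) := by
  have hF := auxF_cont
  have h := Real.tendsto_integral_exp_smul_cocompact
    (indicator (Ioc 0 (Real.pi / 2)) (fun x => (auxF x : ℂ)))
  have hN : Tendsto (fun N : ℕ => (N : ℝ) / Real.pi) atTop (cocompact ℝ) :=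
    (tendsto_natCast_atTop_atTop.atTop_div_const Real.pi_pos).mono_right atTop_le_cocompact
  have h2 := (Complex.continuous_re.tendsto 0).comp (h.comp hN)
  rw [Complex.zero_re] at h2
  refine h2.congr fun N => ?_
  simp only [Function.comp]
  rw [intervalIntegral.integral_of_le (by positivity)]
  have e : (fun v : ℝ => Real.fourierChar (-(v * ((N : ℝ) / Real.pi))) •
      indicator (Ioc 0 (Real.pi / 2)) (fun x => (auxF x : ℂ)) v)
      = indicator (Ioc 0 (Real.pi / 2)) (fun x =>
        Complex.exp (((-(2 * N * x) : ℝ) : ℂ) * Complex.I) * (auxF x : ℂ)) := by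
    ext v
    by_cases hv : v ∈ Ioc 0 (Real.pi / 2)
    · rw [indicator_of_mem hv, indicator_of_mem hv, Circle.smul_def, Real.fourierChar_apply,
        smul_eq_mul]
      congr 4
      have := Real.pi_ne_zero
      field_simp
    · rw [indicator_of_notMem hv, indicator_of_notMem hv, smul_zero]
  rw [e, integral_indicator measurableSet_Ioc]
  have hint : Integrable (fun x : ℝ =>
        Complex.exp (((-(2 * N * x) : ℝ) : ℂ) * Complex.I) * (auxF x : ℂ))
        (volume.restrict (Ioc 0 (Real.pi / 2))) := by
    refine (Continuous.integrableOn_Icc ?_).mono_set Ioc_subset_Icc_self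
    fun_prop
  have := integral_re hint
  refine Eq.trans this.symm ?_
  congr 1
  ext x
  simp only [RCLike.re_to_complex]
  rw [Complex.re_mul_ofReal, Complex.exp_ofReal_mul_I_re, Real.cos_neg]

lemma aux_summ_odd (p : ℕ) (hp : 1 < p) : Summable (fun k : ℕ => 1 / (2 * (k : ℝ) + 1) ^ p) := by
  refine Summable.of_nonneg_of_le (fun k => by positivity) (fun k => ?_) (aux_summ p hp)
  gcongr
  have : (0 : ℝ) ≤ k := by positivity
  linarith

lemma aux_summ_beta (p : ℕ) (hp : 1 < p) :
    Summable (fun k : ℕ => (-1 : ℝ) ^ k / (2 * (k : ℝ) + 1) ^ p) := by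
  refine Summable.of_norm_bounded (aux_summ_odd p hp) fun k => ?_
  rw [norm_div, norm_pow, norm_neg, norm_one, one_pow, Real.norm_of_nonneg (by positivity)]

lemma aux_odd3 : ∑' k : ℕ, 1 / (2 * (k : ℝ) + 1) ^ 3 = 7 / 8 * zetaR 3 := by
  have hs : Summable (fun k : ℕ => 1 / (((2 * k + 1 : ℕ) : ℝ) + 1) ^ 3) :=
    (aux_summ 3 (by norm_num)).comp_injective (i := fun k : ℕ => 2 * k + 1)
      (fun a b h => by simpa using h)
  have hs0 : Summable (fun k : ℕ => 1 / (((2 * k : ℕ) : ℝ) + 1) ^ 3) :=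
    (aux_summ 3 (by norm_num)).comp_injective (i := fun k : ℕ => 2 * k)
      (fun a b h => by simpa using h)
  have h := tsum_even_add_odd (f := fun n : ℕ => 1 / ((n : ℝ) + 1) ^ 3) hs0 hs
  have e : ∑' k : ℕ, 1 / (((2 * k + 1 : ℕ) : ℝ) + 1) ^ 3 = 1 / 8 * zetaR 3 := by
    unfold zetaR
    rw [← tsum_mul_left]
    refine tsum_congr fun k => ?_
    have : (((2 * k + 1 : ℕ) : ℝ) + 1) = 2 * ((k : ℝ) + 1) := by push_cast; ring
    rw [this, mul_pow]
    field_simp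
    norm_num
  rw [e] at h
  push_cast at h
  have : zetaR 3 = ∑' n : ℕ, 1 / ((n : ℝ) + 1) ^ 3 := rfl
  rw [← this] at h
  linarith

/-- ∑_{n=1}^∞ h̄_n/n³ = (7π/2)ζ(3) − (π²/3)G − 8β(4) -/
theorem alt_linear_S_sum_13 :
    (∑' n : ℕ, altOddH 1 (n + 1) / ((n : ℝ) + 1) ^ 3) =
      7 * Real.pi / 2 * zetaR 3 - Real.pi ^ 2 / 3 * betaD 2 - 8 * betaD 4 := by
  have h1 := ((((aux_summ_odd 3 (by norm_num)).hasSum.mul_left (4 * Real.pi)).sub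
    ((aux_summ_beta 2 (by norm_num)).hasSum.mul_left (Real.pi ^ 2 / 3))).sub
    ((aux_summ_beta 4 (by norm_num)).hasSum.mul_left 8)).tendsto_sum_nat
  have h2 := (tendsto_const_nhds (x := ∫ x in (0 : ℝ)..(Real.pi / 2), auxF x)).sub aux_RL
  simp_rw [aux_partial] at h1
  have h3 := tendsto_nhds_unique h2 h1
  rw [sub_zero, auxF_integral, aux_odd3] at h3
  rw [h3]
  unfold betaD
  ring
end

section
/- ∑_{n=1}^∞ h̄_{n-1}/(n-1/2)³ = 8·β(3)·log 2 - 8·β(4) + (7π/8)·ζ(3), where h̄_n = ∑_{k=1}^n (-1)^{k-1}/(k-1/2) with h̄_0 = 0. -/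
open scoped BigOperators

open Real Filter Topology MeasureTheory

noncomputable def Dker (n : ℕ) (x : ℝ) : ℝ :=
  cos x + ∑ k ∈ Finset.range n, (cos ((2 * (k:ℝ) + 3) * x) + cos ((2 * (k:ℝ) + 1) * x))

lemma Dker_cont (n : ℕ) : Continuous (Dker n) := by
  unfold Dker; fun_prop

lemma Dker_abs (n : ℕ) (x : ℝ) : |Dker n x| ≤ 2 * n + 1 := by
  induction n with
  | zero => simpa [Dker] using abs_cos_le_one x
  | succ n ih =>
    have h : Dker (n+1) x = Dker n x + (cos ((2 * (n:ℝ) + 3) * x) + cos ((2 * (n:ℝ) + 1) * x)) := by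
      simp [Dker, Finset.sum_range_succ]; ring
    rw [h]
    have h1 := abs_add_le (Dker n x) (cos ((2 * (n:ℝ) + 3) * x) + cos ((2 * (n:ℝ) + 1) * x))
    have h2 := abs_add_le (cos ((2 * (n:ℝ) + 3) * x)) (cos ((2 * (n:ℝ) + 1) * x))
    have h3 := abs_cos_le_one ((2 * (n:ℝ) + 3) * x)
    have h4 := abs_cos_le_one ((2 * (n:ℝ) + 1) * x)
    push_cast
    linarith

lemma Dker_sin (n : ℕ) (x : ℝ) : sin x * Dker n x = cos x * sin ((2 * n + 1) * x) := by
  induction n with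
  | zero => simp [Dker]; ring
  | succ n ih =>
    have h : Dker (n+1) x = Dker n x + (cos ((2 * (n:ℝ) + 3) * x) + cos ((2 * (n:ℝ) + 1) * x)) := by
      simp [Dker, Finset.sum_range_succ]; ring
    rw [h, mul_add, ih]
    have e1 : (2 * (n:ℝ) + 3) * x = (2 * n + 2) * x + x := by ring
    have e2 : (2 * (n:ℝ) + 1) * x = (2 * n + 2) * x - x := by ring
    have e3 : (2 * ((n + 1 : ℕ):ℝ) + 1) * x = (2 * n + 2) * x + x := by push_cast; ring
    rw [e3, e1, e2, cos_add, cos_sub, sin_sub, sin_add]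
    ring

lemma sin_odd_half (n : ℕ) : sin ((2 * n + 1) * (π / 2)) = (-1 : ℝ) ^ n := by
  have : (2 * (n:ℝ) + 1) * (π / 2) = n * π + π / 2 := by ring
  rw [this, sin_add_pi_div_two, cos_nat_mul_pi]

lemma int_cos_mul (c : ℝ) (hc : c ≠ 0) :
    ∫ x in (0:ℝ)..(π/2), cos (c * x) = sin (c * (π/2)) / c := by
  rw [intervalIntegral.integral_comp_mul_left (fun x => cos x) hc]
  simp; field_simp

lemma Dker_int (n : ℕ) : ∫ x in (0:ℝ)..(π/2), Dker n x =
    2 * (∑ k ∈ Finset.range n, (-1 : ℝ) ^ k / (2 * k + 1)) + (-1 : ℝ) ^ n / (2 * n + 1) := by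
  induction n with
  | zero => simp [Dker]
  | succ n ih =>
    have h : ∀ x, Dker (n+1) x = Dker n x + (cos ((2 * (n:ℝ) + 3) * x) + cos ((2 * (n:ℝ) + 1) * x)) := by
      intro x; simp [Dker, Finset.sum_range_succ]; ring
    simp_rw [h]
    rw [intervalIntegral.integral_add ((Dker_cont n).intervalIntegrable _ _)
      (Continuous.intervalIntegrable (by fun_prop) _ _),
      intervalIntegral.integral_add (Continuous.intervalIntegrable (by fun_prop) _ _)
      (Continuous.intervalIntegrable (by fun_prop) _ _), ih, int_cos_mul _ (by positivity),
      int_cos_mul _ (by positivity), sin_odd_half]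
    have e := sin_odd_half (n+1)
    have e3 : (2 * ((n + 1 : ℕ):ℝ) + 1) = (2 * n + 3) := by push_cast; ring
    rw [e3] at e ⊢
    rw [e, Finset.sum_range_succ]
    ring

lemma bern3 (x : ℝ) : (Polynomial.map (algebraMap ℚ ℝ) (Polynomial.bernoulli 3)).eval x
    = x^3 - 3/2 * x^2 + x/2 := by
  simp_rw [Polynomial.bernoulli, Finset.sum_range_succ, bernoulli_eq_bernoulli'_of_ne_one (n := 2) (by decide), bernoulli_eq_bernoulli'_of_ne_one (n := 3) (by decide)]
  simp [Nat.choose]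
  ring

lemma sinseries (x : ℝ) (h0 : 0 ≤ x) (h1 : x ≤ π) :
    HasSum (fun n : ℕ => sin ((2 * n + 1) * x) / (2 * (n:ℝ) + 1) ^ 3) (π * x * (π - x) / 8) := by
  have hpi := pi_pos
  have a := hasSum_one_div_nat_pow_mul_sin (k := 1) one_ne_zero (x := x / (2 * π))
    ⟨by positivity, by rw [div_le_one (by positivity)]; linarith⟩
  have b := hasSum_one_div_nat_pow_mul_sin (k := 1) one_ne_zero (x := (x + π) / (2 * π))
    ⟨by positivity, by rw [div_le_one (by positivity)]; linarith⟩
  have c := (a.sub b).mul_left (1/2)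
  rw [show 2 * 1 + 1 = 3 from rfl, bern3, bern3] at c
  have inj : Function.Injective (fun n : ℕ => 2 * n + 1) := fun a b h => by simpa using h
  have hs : ∀ n : ℕ, sin (2 * π * n * ((x + π) / (2 * π))) = (-1)^n * sin (n * x) := by
    intro n
    rw [← sin_add_nat_mul_pi]; congr 1; field_simp
  have hs' : ∀ n : ℕ, sin (2 * π * n * (x / (2 * π))) = sin (n * x) := by
    intro n
    congr 1; field_simp
  simp_rw [hs, hs'] at c
  rw [← inj.hasSum_iff] at c
  · convert! c using 1
    · ext n
      simp only [Function.comp]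
      rw [Odd.neg_one_pow ⟨n, rfl⟩]
      push_cast
      ring
    · simp [Nat.factorial]
      field_simp
      ring
  · intro n hn
    have he : Even n := by
      rw [← Nat.not_odd_iff_even]
      rintro ⟨k, hk⟩
      exact hn ⟨k, hk.symm⟩
    rw [he.neg_one_pow]; ring

lemma log2series : Tendsto (fun n => ∑ i ∈ Finset.range n, (-1 : ℝ) ^ i / ((i:ℝ) + 1)) atTop
    (𝓝 (log 2)) := by
  obtain ⟨l, h⟩ :
      ∃ l, Tendsto (fun n ↦ ∑ i ∈ Finset.range n, (-1 : ℝ) ^ i / ((i:ℝ) + 1)) atTop (𝓝 l) := by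
    apply Antitone.tendsto_alternating_series_of_tendsto_zero
    · exact antitone_iff_forall_lt.mpr fun _ _ _ ↦ by gcongr
    · apply Tendsto.inv_tendsto_atTop; apply tendsto_atTop_add_const_right
      exact tendsto_natCast_atTop_atTop
  have abel := tendsto_tsum_powerSeries_nhdsWithin_lt h
  have m : 𝓝[<] (1 : ℝ) ≤ 𝓝 1 := tendsto_nhdsWithin_of_tendsto_nhds fun _ a ↦ a
  replace abel := abel.mul m
  rw [mul_one] at abel
  replace abel : Tendsto (fun x : ℝ => log (1 + x)) (𝓝[<] 1) (𝓝 l) := by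
    apply abel.congr'
    rw [eventuallyEq_nhdsWithin_iff, Metric.eventually_nhds_iff]
    use 1, zero_lt_one
    intro y hy1 hy2
    rw [dist_eq, abs_sub_lt_iff] at hy1
    rw [Set.mem_Iio] at hy2
    have ny : |-y| < 1 := by rw [abs_lt]; constructor <;> linarith
    have hh := (hasSum_pow_div_log_of_abs_lt_one ny).neg
    rw [neg_neg, sub_neg_eq_add] at hh
    rw [← hh.tsum_eq, ← tsum_mul_right]
    congr 1
    ext n
    rw [neg_pow y]
    ring
  have hc : Tendsto (fun x : ℝ => log (1 + x)) (𝓝 1) (𝓝 (log (1 + 1))) :=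
    ContinuousAt.tendsto (f := fun x : ℝ => log (1 + x)) (ContinuousAt.log (by fun_prop) (by norm_num))
  rw [tendsto_nhds_unique abel (hc.mono_left m)] at h
  norm_num at h ⊢
  exact h

lemma coef (m : ℕ) : ∫ x in (0:ℝ)..(π/2), 2 * sin (2 * ((m:ℝ) + 1) * x) * (x * (π - x)) =
    π ^ 2 / 4 * ((-1) ^ m / ((m:ℝ) + 1)) + (1 / ((m:ℝ) + 1) ^ 3 - (1 - (-1) ^ m) / 2 / ((m:ℝ) + 1) ^ 3) := by
  set c : ℝ := (m:ℝ) + 1 with hc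
  have hc0 : c ≠ 0 := by positivity
  have hd : ∀ x ∈ Set.uIcc (0:ℝ) (π/2), HasDerivAt
      (fun x => - (x * (π - x)) * cos (2 * c * x) / c + (π - 2 * x) * sin (2 * c * x) / (2 * c ^ 2)
        - cos (2 * c * x) / (2 * c ^ 3)) (2 * sin (2 * c * x) * (x * (π - x))) x := by
    intro x _
    have h1 : HasDerivAt (fun x : ℝ => 2 * c * x) (2 * c) x := by
      simpa using (hasDerivAt_id x).const_mul (2 * c)
    have h2 : HasDerivAt (fun x : ℝ => π - x) (-1) x := by
      simpa using (hasDerivAt_id x).const_sub π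
    have h3 : HasDerivAt (fun x : ℝ => π - 2 * x) (-2) x := by
      simpa using ((hasDerivAt_id x).const_mul 2).const_sub π
    have h4 := (((((hasDerivAt_id x).mul h2).neg.mul h1.cos).div_const c).add
      ((h3.mul h1.sin).div_const (2 * c ^ 2))).sub (h1.cos.div_const (2 * c ^ 3))
    convert! h4 using 1
    simp
    field_simp
    ring
  rw [intervalIntegral.integral_eq_sub_of_hasDerivAt hd
    (Continuous.intervalIntegrable (by fun_prop) _ _)]
  have e1 : 2 * c * (π / 2) = ((m + 1 : ℕ) : ℝ) * π := by rw [hc]; push_cast; ring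
  rw [e1, cos_nat_mul_pi, sin_nat_mul_pi]
  simp
  rw [pow_succ]
  field_simp
  ring

lemma kerident (M : ℕ) (x : ℝ) (hx : sin x ≠ 0) :
    cos x / sin x * (x * (π - x)) - ∑ m ∈ Finset.range M, 2 * sin (2 * ((m:ℝ) + 1) * x) * (x * (π - x))
     = x * (π - x) / sin x * cos ((2 * M + 1) * x) := by
  induction M with
  | zero => simp; ring
  | succ M ih =>
    rw [Finset.sum_range_succ, ← sub_sub, ih]
    have e1 : (2 * (M:ℝ) + 1) * x = 2 * ((M:ℝ) + 1) * x - x := by ring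
    have e3 : (2 * ((M + 1 : ℕ):ℝ) + 1) * x = 2 * ((M:ℝ) + 1) * x + x := by push_cast; ring
    rw [e1, e3, cos_sub, cos_add]
    field_simp
    ring

lemma phi_int : IntervalIntegrable (fun x => x * (π - x) / sin x) volume 0 (π/2) := by
  have hpi := pi_pos
  refine IntervalIntegrable.mono_fun' (g := fun _ => π ^ 2 / 2) (by simp) ?_ ?_
  · apply Measurable.aestronglyMeasurable
    fun_prop
  · rw [Set.uIoc_of_le (by positivity)]
    refine (ae_restrict_iff' measurableSet_Ioc).2 (Eventually.of_forall ?_)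
    rintro x ⟨h0, h1⟩
    have h := mul_le_sin h0.le h1
    have hp : 0 < 2 / π * x := by positivity
    have hs : 0 < sin x := lt_of_lt_of_le hp h
    have hq : 0 ≤ π - x := by linarith
    show ‖x * (π - x) / sin x‖ ≤ π ^ 2 / 2
    rw [Real.norm_of_nonneg (by positivity), div_le_iff₀ hs]
    calc x * (π - x) ≤ x * π := by gcongr; linarith
      _ = π ^ 2 / 2 * (2 / π * x) := by field_simp
      _ ≤ _ := by gcongr

lemma RL (f : ℝ → ℝ) (hf : IntervalIntegrable f volume 0 (π/2)) :
    Tendsto (fun M : ℕ => ∫ x in (0:ℝ)..(π/2), f x * cos ((2 * M + 1) * x)) atTop (𝓝 0) := by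
  have hpi := pi_pos
  have h := Real.tendsto_integral_exp_smul_cocompact
    (Set.indicator (Set.Ioc 0 (π/2)) (fun x => (f x : ℂ)))
  have hw : Tendsto (fun M : ℕ => (2 * (M:ℝ) + 1) / (2 * π)) atTop (cocompact ℝ) := by
    refine Tendsto.mono_right ?_ atTop_le_cocompact
    apply Tendsto.atTop_div_const (by positivity)
    apply tendsto_atTop_add_const_right
    exact tendsto_natCast_atTop_atTop.const_mul_atTop zero_lt_two
  have h2 := (Complex.continuous_re.tendsto _).comp (h.comp hw)
  simp only [Complex.zero_re] at h2
  refine h2.congr fun M => ?_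
  simp only [Function.comp]
  have e : ∀ v : ℝ, (fourierChar (-(v * ((2 * (M:ℝ) + 1) / (2 * π))))) •
      (Set.indicator (Set.Ioc 0 (π/2)) (fun x => (f x : ℂ))) v
      = Set.indicator (Set.Ioc 0 (π/2)) (fun x => Complex.exp (((-((2 * M + 1) * x) : ℝ) : ℂ) * Complex.I) * (f x : ℂ)) v := by
    intro v
    by_cases hv : v ∈ Set.Ioc 0 (π/2)
    · rw [Set.indicator_of_mem hv, Set.indicator_of_mem hv, Circle.smul_def, fourierChar_apply, smul_eq_mul]
      congr 4
      field_simp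
    · rw [Set.indicator_of_notMem hv, Set.indicator_of_notMem hv, smul_zero]
  simp_rw [e]
  rw [integral_indicator measurableSet_Ioc, intervalIntegral.integral_of_le (by positivity)]
  have hi : Integrable (fun x => Complex.exp (((-((2 * M + 1) * x) : ℝ) : ℂ) * Complex.I) * (f x : ℂ))
      (volume.restrict (Set.Ioc 0 (π/2))) := by
    have hf' : Integrable (fun x => (f x : ℂ)) (volume.restrict (Set.Ioc 0 (π/2))) :=
      ((intervalIntegrable_iff_integrableOn_Ioc_of_le (by positivity)).1 hf).ofReal
    refine hf'.bdd_mul (c := 1) ?_ ?_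
    · apply Continuous.aestronglyMeasurable
      fun_prop
    · refine Eventually.of_forall fun x => ?_
      rw [Complex.norm_exp_ofReal_mul_I]
  have := integral_re (𝕜 := ℂ) hi
  simp only [RCLike.re_to_complex] at this
  rw [← this]
  congr 1
  ext x
  rw [Complex.mul_re, Complex.exp_ofReal_mul_I_re, Complex.ofReal_re, Complex.ofReal_im, cos_neg]
  ring

lemma oddzeta : HasSum (fun m : ℕ => 1 / ((m:ℝ) + 1) ^ 3 - (1 - (-1:ℝ) ^ m) / 2 / ((m:ℝ) + 1) ^ 3)
    (7 / 8 * zetaR 3) := by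
  have hs : Summable (fun m : ℕ => 1 / ((m:ℝ) + 1) ^ 3) := by
    have := (summable_nat_add_iff 1).2 (Real.summable_one_div_nat_pow.2 (by norm_num : 1 < 3))
    simpa using this
  have h1 : HasSum (fun m : ℕ => 1 / ((m:ℝ) + 1) ^ 3) (zetaR 3) := hs.hasSum
  have inj : Function.Injective (fun n : ℕ => 2 * n + 1) := fun a b h => by simpa using h
  have h2 : HasSum (fun m : ℕ => (1 - (-1:ℝ) ^ m) / 2 / ((m:ℝ) + 1) ^ 3) (1 / 8 * zetaR 3) := by
    rw [← inj.hasSum_iff]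
    · convert! h1.mul_left (1/8) using 1
      ext n
      simp only [Function.comp]
      rw [Odd.neg_one_pow ⟨n, rfl⟩]
      push_cast
      norm_num
      rw [show 2 * (n:ℝ) + 1 + 1 = 2 * (n + 1) by ring]
      field_simp
      norm_num
    · intro n hn
      have he : Even n := by
        rw [← Nat.not_odd_iff_even]
        rintro ⟨k, hk⟩
        exact hn ⟨k, hk.symm⟩
      rw [he.neg_one_pow]; ring
  convert! h1.sub h2 using 1
  ring

lemma sin_pos' {x : ℝ} (hx : x ∈ Set.Ioc 0 (π/2)) : sin x ≠ 0 :=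
  (sin_pos_of_pos_of_lt_pi hx.1 (by have := hx.2; have := pi_pos; linarith)).ne'

lemma Kval : ∫ x in (0:ℝ)..(π/2), cos x / sin x * (x * (π - x)) =
    π ^ 2 / 4 * log 2 + 7 / 8 * zetaR 3 := by
  have hpi := pi_pos
  have h1 := RL _ phi_int
  have hI : IntervalIntegrable (fun x => cos x / sin x * (x * (π - x))) volume 0 (π/2) := by
    have := phi_int.mul_continuousOn (g := cos) (by fun_prop)
    refine this.congr fun x _ => ?_
    ring
  have h2 : ∀ M : ℕ, ∫ x in (0:ℝ)..(π/2), (x * (π - x) / sin x) * cos ((2 * M + 1) * x) =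
      (∫ x in (0:ℝ)..(π/2), cos x / sin x * (x * (π - x))) - (π ^ 2 / 4 * ∑ m ∈ Finset.range M,
        ((-1) ^ m / ((m:ℝ) + 1)) + ∑ m ∈ Finset.range M,
          (1 / ((m:ℝ) + 1) ^ 3 - (1 - (-1:ℝ) ^ m) / 2 / ((m:ℝ) + 1) ^ 3)) := by
    intro M
    rw [Finset.mul_sum, ← Finset.sum_add_distrib]
    simp_rw [← coef]
    rw [← intervalIntegral.integral_finsetSum
      (fun i _ => Continuous.intervalIntegrable (by fun_prop) _ _),
      ← intervalIntegral.integral_sub hI (Continuous.intervalIntegrable (by fun_prop) _ _)]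
    refine intervalIntegral.integral_congr_ae (Eventually.of_forall fun x hx => ?_)
    rw [Set.uIoc_of_le (by positivity)] at hx
    exact (kerident M x (sin_pos' hx)).symm
  simp_rw [h2] at h1
  have h3 := (tendsto_const_nhds (x := ∫ x in (0:ℝ)..(π/2), cos x / sin x * (x * (π - x)))).sub
    ((log2series.const_mul (π ^ 2 / 4)).add oddzeta.tendsto_sum_nat)
  have := tendsto_nhds_unique h1 h3
  linarith

lemma Dsum : HasSum (fun n : ℕ => (∫ x in (0:ℝ)..(π/2), Dker n x) / (2 * (n:ℝ) + 1) ^ 3)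
    (π / 8 * (π ^ 2 / 4 * log 2 + 7 / 8 * zetaR 3)) := by
  have hpi := pi_pos
  rw [← Kval, ← intervalIntegral.integral_const_mul]
  simp_rw [← intervalIntegral.integral_div]
  have hsum : Summable (fun n : ℕ => 1 / (2 * (n:ℝ) + 1) ^ 2) := by
    have := (Real.summable_one_div_nat_pow.2 (by norm_num : 1 < 2)).comp_injective
      (i := fun n : ℕ => 2 * n + 1) (fun a b h => by simpa using h)
    refine this.congr fun n => ?_
    simp
  refine intervalIntegral.hasSum_integral_of_dominated_convergence
    (fun n _ => 1 / (2 * (n:ℝ) + 1) ^ 2) ?_ ?_ ?_ ?_ ?_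
  · intro n
    exact ((Dker_cont n).div_const _).aestronglyMeasurable
  · intro n
    refine Eventually.of_forall fun x _ => ?_
    rw [norm_div, Real.norm_eq_abs, Real.norm_of_nonneg (by positivity)]
    rw [div_le_div_iff₀ (by positivity) (by positivity)]
    have := Dker_abs n x
    calc |Dker n x| * (2 * (n:ℝ) + 1) ^ 2 ≤ (2 * (n:ℝ) + 1) * (2 * (n:ℝ) + 1) ^ 2 := by gcongr
      _ = _ := by ring
  · exact Eventually.of_forall fun x _ => hsum
  · simp
  · refine Eventually.of_forall fun x hx => ?_
    rw [Set.uIoc_of_le (by positivity)] at hx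
    have hs := sin_pos' hx
    convert! (sinseries x hx.1.le (by linarith [hx.2])).mul_left (cos x / sin x) using 1
    · ext n
      have := Dker_sin n x
      field_simp
      linarith
    · ring

lemma beta3 : betaD 3 = π ^ 3 / 32 := by
  have hpi := pi_pos
  have h := sinseries (π/2) (by positivity) (by linarith)
  simp_rw [sin_odd_half] at h
  rw [betaD, h.tsum_eq]
  ring

lemma beta4 : HasSum (fun n : ℕ => (-1 : ℝ) ^ n / (2 * (n : ℝ) + 1) ^ 4) (betaD 4) := by
  apply Summable.hasSum
  have := (Real.summable_one_div_nat_pow.2 (by norm_num : 1 < 4)).comp_injective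
    (i := fun n : ℕ => 2 * n + 1) (fun a b h => by simpa using h)
  refine Summable.of_norm_bounded this fun n => ?_
  rw [norm_div, norm_pow, norm_neg, norm_one, one_pow, Real.norm_of_nonneg (by positivity)]
  simp

/-- ∑_{n=1}^∞ h̄_{n−1}/(n−1/2)³ = 8β(3)·log 2 − 8β(4) + (7π/8)ζ(3) -/
theorem alt_linear_T_sum_13 :
    (∑' n : ℕ, altOddH 1 n / ((n : ℝ) + 1 / 2) ^ 3) =
      8 * betaD 3 * Real.log 2 - 8 * betaD 4 + 7 * Real.pi / 8 * zetaR 3 := by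
  have h := (Dsum.sub beta4).mul_left 8
  have e : ∀ n : ℕ, altOddH 1 n / ((n : ℝ) + 1 / 2) ^ 3 =
      8 * ((∫ x in (0:ℝ)..(π/2), Dker n x) / (2 * (n:ℝ) + 1) ^ 3
        - (-1 : ℝ) ^ n / (2 * (n : ℝ) + 1) ^ 4) := by
    intro n
    have e1 : altOddH 1 n = 2 * ∑ k ∈ Finset.range n, (-1 : ℝ) ^ k / (2 * k + 1) := by
      rw [altOddH, Finset.mul_sum]
      refine Finset.sum_congr rfl fun k _ => ?_
      field_simp
    rw [Dker_int, e1]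
    rw [show (n:ℝ) + 1 / 2 = (2 * n + 1) / 2 by ring]
    field_simp
    ring
  simp_rw [e]
  rw [h.tsum_eq, beta3]
  ring
end

section
/- ∑_{n=1}^∞ (-1)^{n-1}·h̄_{n-1}/(n-1/2)² = (π²/2)·log 2 - (7/2)·ζ(3), where h̄_n = ∑_{k=1}^n (-1)^{k-1}/(k-1/2) with h̄_0 = 0. -/
open scoped BigOperators

open Filter Topology

namespace AltT

/-- half-odd integers -/
noncomputable def hx (k : ℕ) : ℝ := (k : ℝ) + 1 / 2

lemma hx_pos (k : ℕ) : 0 < hx k := by unfold hx; positivity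

lemma hx_shift (j k : ℕ) : hx (j + (k + 1)) = hx k + ((j : ℝ) + 1) := by
  unfold hx; push_cast; ring

/-- alternating harmonic numbers -/
noncomputable def Hb (n : ℕ) : ℝ := ∑ i ∈ Finset.range n, (-1 : ℝ) ^ i / ((i : ℝ) + 1)

lemma altOddH_eq (n : ℕ) : altOddH 1 n = ∑ k ∈ Finset.range n, (-1 : ℝ) ^ k / hx k := by
  simp [altOddH, hx]

lemma shift_tendsto {a : ℕ → ℝ} {l : ℝ}
    (h : Tendsto (fun n ↦ ∑ i ∈ Finset.range n, a i) atTop (𝓝 l)) (c : ℕ) :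
    Tendsto (fun n ↦ ∑ i ∈ Finset.range n, a (i + c)) atTop
      (𝓝 (l - ∑ i ∈ Finset.range c, a i)) := by
  have h1 := (h.comp (tendsto_add_atTop_nat c)).sub_const (∑ i ∈ Finset.range c, a i)
  refine h1.congr fun n ↦ ?_
  simp only [Function.comp]
  rw [add_comm n c, Finset.sum_range_add]
  simp [add_comm]

lemma antidiag {F : ℕ × ℕ → ℝ} {a : ℝ} (h : HasSum F a) :
    HasSum (fun s ↦ ∑ p ∈ Finset.HasAntidiagonal.antidiagonal s, F p) a := by
  have h1 := (Finset.HasAntidiagonal.sigmaAntidiagonalEquivProd (A := ℕ)).hasSum_iff.2 h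
  refine h1.sigma fun s ↦ ?_
  have := hasSum_fintype (fun p : Finset.HasAntidiagonal.antidiagonal s ↦ F p)
  rw [Finset.sum_coe_sort (Finset.HasAntidiagonal.antidiagonal s) F] at this
  exact this

lemma swap_hasSum {F : ℕ × ℕ → ℝ} {a : ℝ} (h : HasSum F a) :
    HasSum (fun p : ℕ × ℕ ↦ F (p.2, p.1)) a :=
  (Equiv.prodComm ℕ ℕ).hasSum_iff.2 h

lemma tendsto_log_two :
    Tendsto (fun n ↦ ∑ i ∈ Finset.range n, (-1 : ℝ) ^ i / ((i : ℝ) + 1)) atTop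
      (𝓝 (Real.log 2)) := by
  obtain ⟨l, h⟩ : ∃ l, Tendsto (fun n ↦ ∑ i ∈ Finset.range n, (-1 : ℝ) ^ i * (1 / ((i : ℝ) + 1)))
      atTop (𝓝 l) := by
    apply Antitone.tendsto_alternating_series_of_tendsto_zero
    · intro a b hab
      have : (a : ℝ) ≤ b := by exact_mod_cast hab
      dsimp only
      gcongr
    · exact tendsto_one_div_add_atTop_nhds_zero_nat
  have abel := Real.tendsto_tsum_powerSeries_nhdsWithin_lt h
  have h2 : Tendsto (fun x : ℝ ↦ Real.log (1 + x) / x) (𝓝[<] 1) (𝓝 (Real.log 2)) := by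
    have : ContinuousAt (fun x : ℝ ↦ Real.log (1 + x) / x) 1 := by
      refine ContinuousAt.div (ContinuousAt.log (by fun_prop) (by norm_num)) (by fun_prop)
        (by norm_num)
    have h3 := this.tendsto
    norm_num at h3
    exact h3.mono_left nhdsWithin_le_nhds
  have h4 : (fun x : ℝ ↦ ∑' n : ℕ, (-1 : ℝ) ^ n * (1 / ((n : ℝ) + 1)) * x ^ n) =ᶠ[𝓝[<] 1]
      fun x : ℝ ↦ Real.log (1 + x) / x := by
    have : Set.Ioo (0 : ℝ) 1 ∈ 𝓝[<] (1 : ℝ) := Ioo_mem_nhdsLT (by norm_num)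
    filter_upwards [this] with x hx
    have hs := Real.hasSum_pow_div_log_of_abs_lt_one (x := -x)
      (by rw [abs_neg, abs_of_pos hx.1]; exact hx.2)
    have hs2 := hs.mul_left (-1 / x)
    have hx0 : x ≠ 0 := hx.1.ne'
    have e : -1 / x * -Real.log (1 - -x) = Real.log (1 + x) / x := by
      rw [sub_neg_eq_add]; field_simp
    rw [e] at hs2
    rw [← hs2.tsum_eq]
    refine tsum_congr fun n ↦ ?_
    have : (n : ℝ) + 1 ≠ 0 := by positivity
    rw [neg_pow x]
    field_simp
    ring
  have := tendsto_nhds_unique (abel.congr' h4) h2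
  rw [← this]
  refine h.congr fun n ↦ Finset.sum_congr rfl fun i _ ↦ by ring

lemma exists_P : ∃ P : ℝ, Tendsto (fun n ↦ ∑ i ∈ Finset.range n, (-1 : ℝ) ^ i / hx i) atTop
      (𝓝 P) := by
  obtain ⟨l, h⟩ : ∃ l, Tendsto (fun n ↦ ∑ i ∈ Finset.range n, (-1 : ℝ) ^ i * (1 / hx i))
      atTop (𝓝 l) := by
    apply Antitone.tendsto_alternating_series_of_tendsto_zero
    · intro a b hab
      have : (a : ℝ) ≤ b := by exact_mod_cast hab
      have := hx_pos a
      dsimp only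
      gcongr
      unfold hx; gcongr
    · refine Tendsto.const_div_atTop ?_ _
      exact tendsto_atTop_add_const_right _ _ tendsto_natCast_atTop_atTop
  exact ⟨l, h.congr fun n ↦ Finset.sum_congr rfl fun i _ ↦ by ring⟩

lemma hasSum_hx_pow {p : ℕ} {z : ℝ}
    (h : HasSum (fun n : ℕ ↦ 1 / (n : ℝ) ^ p) z) :
    HasSum (fun k ↦ 1 / hx k ^ p) ((2 ^ p - 1) * z) := by
  have he : HasSum (fun k : ℕ ↦ 1 / ((2 * k : ℕ) : ℝ) ^ p) (1 / 2 ^ p * z) := by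
    have h1 := h.mul_left (1 / 2 ^ p)
    have e : (fun k : ℕ ↦ 1 / ((2 * k : ℕ) : ℝ) ^ p) =
        fun k : ℕ ↦ 1 / 2 ^ p * (1 / (k : ℝ) ^ p) := by
      funext k
      push_cast
      rw [mul_pow, one_div_mul_one_div]
    rw [e]
    exact h1
  have ho : Summable (fun k : ℕ ↦ 1 / ((2 * k + 1 : ℕ) : ℝ) ^ p) :=
    h.summable.comp_injective (i := fun k : ℕ ↦ 2 * k + 1) (fun a b hab ↦ by simpa using hab)
  have hu := (HasSum.even_add_odd (f := fun n : ℕ ↦ 1 / (n : ℝ) ^ p) he ho.hasSum).unique h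
  have h2 := ho.hasSum.mul_left (2 ^ p)
  have e : (2 : ℝ) ^ p * ∑' k : ℕ, 1 / ((2 * k + 1 : ℕ) : ℝ) ^ p = (2 ^ p - 1) * z := by
    have e1 : ∑' k : ℕ, 1 / ((2 * k + 1 : ℕ) : ℝ) ^ p = z - 1 / 2 ^ p * z := by linarith
    rw [e1]
    field_simp
  rw [e] at h2
  have e2 : (fun k ↦ 1 / hx k ^ p) =
      fun k : ℕ ↦ (2 : ℝ) ^ p * (1 / ((2 * k + 1 : ℕ) : ℝ) ^ p) := by
    funext k
    have : hx k = ((2 * k + 1 : ℕ) : ℝ) / 2 := by unfold hx; push_cast; ring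
    rw [this, div_pow]
    field_simp
  rw [e2]
  exact h2

lemma summable_three_half (a : ℝ) (ha : 0 < a) :
    Summable (fun k : ℕ ↦ (1 / ((k : ℝ) + a)) * (1 / √((k : ℝ) + a))) := by
  have h := (Real.summable_one_div_nat_add_rpow a (3 / 2)).2 (by norm_num)
  refine h.congr fun k ↦ ?_
  have hp : 0 < (k : ℝ) + a := by positivity
  rw [abs_of_pos hp, one_div_mul_one_div, Real.sqrt_eq_rpow]
  congr 1
  rw [show (3 / 2 : ℝ) = 1 + 1 / 2 by norm_num, Real.rpow_add hp, Real.rpow_one]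

lemma prod_bound {a b : ℝ} (ha : 0 < a) (hb : 0 < b) :
    1 / (a * b * (a + b)) ≤ (1 / a * (1 / √a)) * (1 / b * (1 / √b)) := by
  have h1 : √a * √b ≤ a + b := by
    nlinarith [Real.sq_sqrt ha.le, Real.sq_sqrt hb.le, sq_nonneg (√a - √b)]
  have ha' := Real.sqrt_pos.2 ha
  have hb' := Real.sqrt_pos.2 hb
  have e : (1 / a * (1 / √a)) * (1 / b * (1 / √b)) = 1 / (a * b * (√a * √b)) := by
    field_simp
  rw [e]
  gcongr

/-- absolutely convergent majorant -/
lemma summable_f0 : Summable (fun p : ℕ × ℕ ↦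
    1 / (((p.1 : ℝ) + 1) * hx p.2 * (hx p.2 + ((p.1 : ℝ) + 1)))) := by
  have h := (summable_three_half 1 one_pos).mul_of_nonneg
    (summable_three_half (1 / 2) (by norm_num)) (fun k ↦ by positivity) (fun k ↦ by positivity)
  refine Summable.of_nonneg_of_le (fun p ↦ ?_) (fun p ↦ ?_) h
  · have := hx_pos p.2
    positivity
  · have := prod_bound (a := (p.1 : ℝ) + 1) (b := hx p.2) (by positivity) (hx_pos _)
    rw [add_comm (hx p.2)]
    exact this

lemma summable_g0 : Summable (fun p : ℕ × ℕ ↦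
    1 / (hx p.1 * hx p.2 * (hx p.1 + hx p.2))) := by
  have h := (summable_three_half (1 / 2) (by norm_num)).mul_of_nonneg
    (summable_three_half (1 / 2) (by norm_num)) (fun k ↦ by positivity) (fun k ↦ by positivity)
  refine Summable.of_nonneg_of_le (fun p ↦ ?_) (fun p ↦ ?_) h
  · have := hx_pos p.2
    have := hx_pos p.1
    positivity
  · exact prod_bound (hx_pos _) (hx_pos _)

noncomputable def f (p : ℕ × ℕ) : ℝ :=
  (-1) ^ (p.1 + 1) / (((p.1 : ℝ) + 1) * hx p.2 * (hx p.2 + ((p.1 : ℝ) + 1)))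

noncomputable def g (p : ℕ × ℕ) : ℝ :=
  (-1) ^ (p.1 + p.2 + 1) / (hx p.1 * hx p.2 * (hx p.1 + hx p.2))

noncomputable def c (p : ℕ × ℕ) : ℝ :=
  (-1) ^ p.1 / (((p.1 : ℝ) + 1) * (hx p.2 + ((p.1 : ℝ) + 1)) ^ 2)

lemma summable_f : Summable f := by
  refine Summable.of_norm_bounded summable_f0 fun p ↦ ?_
  have := hx_pos p.2
  unfold f
  rw [norm_div, norm_pow, norm_neg, norm_one, one_pow, Real.norm_of_nonneg (by positivity)]

lemma summable_g : Summable g := by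
  refine Summable.of_norm_bounded summable_g0 fun p ↦ ?_
  have := hx_pos p.2
  have := hx_pos p.1
  unfold g
  rw [norm_div, norm_pow, norm_neg, norm_one, one_pow, Real.norm_of_nonneg (by positivity)]

lemma summable_c : Summable c := by
  refine Summable.of_norm_bounded summable_f0 fun p ↦ ?_
  have := hx_pos p.2
  unfold c
  rw [norm_div, norm_pow, norm_neg, norm_one, one_pow, Real.norm_of_nonneg (by positivity)]
  have h1 : hx p.2 ≤ hx p.2 + ((p.1 : ℝ) + 1) := by
    have : (0 : ℝ) ≤ p.1 := by positivity
    linarith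
  rw [pow_two, ← mul_assoc]
  gcongr

/-- column sums of `f` -/
lemma f_col {P : ℝ}
    (hP : Tendsto (fun n ↦ ∑ i ∈ Finset.range n, (-1 : ℝ) ^ i / hx i) atTop (𝓝 P)) (k : ℕ) :
    HasSum (fun j ↦ f (j, k))
      (1 / hx k ^ 2 * (-Real.log 2 - (-1) ^ k * (P - altOddH 1 (k + 1)))) := by
  have hs : Summable (fun j ↦ f (j, k)) :=
    ((Equiv.prodComm ℕ ℕ).summable_iff.2 summable_f).prod_factor k
  rw [hs.hasSum_iff_tendsto_nat]
  have h1 := ((tendsto_log_two.neg).sub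
    ((shift_tendsto hP (k + 1)).const_mul ((-1) ^ k))).const_mul (1 / hx k ^ 2)
  rw [← altOddH_eq] at h1
  refine h1.congr fun n ↦ ?_
  rw [Finset.mul_sum, ← Finset.sum_neg_distrib, ← Finset.sum_sub_distrib, Finset.mul_sum]
  refine Finset.sum_congr rfl fun j _ ↦ ?_
  rw [hx_shift]
  unfold f
  have := hx_pos k
  have h3 : (-1 : ℝ) ^ k * (-1) ^ k = 1 := by rw [← mul_pow]; simp
  have h2 : (-1 : ℝ) ^ k * ((-1) ^ (j + (k + 1)) / (hx k + ((j : ℝ) + 1))) =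
      - (-1) ^ j / (hx k + ((j : ℝ) + 1)) := by
    rw [← mul_div_assoc]
    congr 1
    rw [pow_add, pow_succ]
    linear_combination (-(-1 : ℝ) ^ j) * h3
  rw [h2]
  dsimp only
  rw [pow_succ]
  field_simp
  ring

/-- column sums of `g` -/
lemma g_col {P : ℝ}
    (hP : Tendsto (fun n ↦ ∑ i ∈ Finset.range n, (-1 : ℝ) ^ i / hx i) atTop (𝓝 P)) (k : ℕ) :
    HasSum (fun j ↦ g (j, k))
      (1 / hx k ^ 2 * (Real.log 2 - Hb k - (-1) ^ k * P)) := by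
  have hs : Summable (fun j ↦ g (j, k)) :=
    ((Equiv.prodComm ℕ ℕ).summable_iff.2 summable_g).prod_factor k
  rw [hs.hasSum_iff_tendsto_nat]
  have h1 := ((shift_tendsto tendsto_log_two k).sub
    (hP.const_mul ((-1) ^ k))).const_mul (1 / hx k ^ 2)
  refine h1.congr fun n ↦ ?_
  rw [Finset.mul_sum, ← Finset.sum_sub_distrib, Finset.mul_sum]
  refine Finset.sum_congr rfl fun j _ ↦ ?_
  unfold g
  have := hx_pos k
  have := hx_pos j
  dsimp only
  have e : ((j + k : ℕ) : ℝ) + 1 = hx j + hx k := by unfold hx; push_cast; ring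
  rw [e, pow_succ, pow_add]
  field_simp
  ring

/-- row sums of `f` -/
lemma f_row (j : ℕ) :
    HasSum (fun k ↦ f (j, k))
      ((-1) ^ (j + 1) / ((j : ℝ) + 1) ^ 2 * ∑ k ∈ Finset.range (j + 1), 1 / hx k) := by
  have hs : Summable (fun k ↦ f (j, k)) := summable_f.prod_factor j
  rw [hs.hasSum_iff_tendsto_nat]
  have h0 : Tendsto (fun n ↦ 1 / hx n) atTop (𝓝 0) := by
    refine Tendsto.const_div_atTop ?_ _
    exact tendsto_atTop_add_const_right _ _ tendsto_natCast_atTop_atTop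
  have h1 : Tendsto (fun n ↦ ∑ i ∈ Finset.range (j + 1), 1 / hx (n + i)) atTop (𝓝 0) := by
    have := tendsto_finsetSum (Finset.range (j + 1))
      (fun i _ ↦ h0.comp (tendsto_add_atTop_nat i))
    simpa using this
  have h2 := (h1.const_sub (∑ k ∈ Finset.range (j + 1), 1 / hx k)).const_mul
    ((-1) ^ (j + 1) / ((j : ℝ) + 1) ^ 2)
  rw [sub_zero] at h2
  refine h2.congr fun n ↦ ?_
  have e1 := Finset.sum_range_add (fun i ↦ 1 / hx i) n (j + 1)
  have e2 := Finset.sum_range_add (fun i ↦ 1 / hx i) (j + 1) n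
  rw [add_comm (j + 1) n] at e2
  have e3 : ∑ k ∈ Finset.range (j + 1), 1 / hx k -
      ∑ i ∈ Finset.range (j + 1), 1 / hx (n + i) =
      ∑ k ∈ Finset.range n, (1 / hx k - 1 / hx (j + 1 + k)) := by
    rw [Finset.sum_sub_distrib]
    linarith
  rw [e3, Finset.mul_sum]
  refine Finset.sum_congr rfl fun k _ ↦ ?_
  have := hx_pos k
  rw [show j + 1 + k = j + (k + 1) by ring, hx_shift]
  unfold f
  dsimp only
  field_simp
  ring

/-- antidiagonal sums of `g` -/
lemma g_diag (s : ℕ) :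
    ∑ p ∈ Finset.HasAntidiagonal.antidiagonal s, g p =
      2 * ((-1) ^ (s + 1) / ((s : ℝ) + 1) ^ 2 * ∑ k ∈ Finset.range (s + 1), 1 / hx k) := by
  have h1 : ∀ p ∈ Finset.HasAntidiagonal.antidiagonal s, g p =
      (-1) ^ (s + 1) / ((s : ℝ) + 1) ^ 2 * (1 / hx p.1 + 1 / hx p.2) := by
    intro p hp
    rw [Finset.HasAntidiagonal.mem_antidiagonal] at hp
    have := hx_pos p.1
    have := hx_pos p.2
    have e : (s : ℝ) + 1 = hx p.1 + hx p.2 := by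
      rw [← hp]; unfold hx; push_cast; ring
    unfold g
    rw [hp, e]
    field_simp
    ring
  rw [Finset.sum_congr rfl h1, ← Finset.mul_sum, Finset.sum_add_distrib,
    Finset.Nat.sum_antidiagonal_eq_sum_range_succ (fun i _ ↦ 1 / hx i),
    ← Finset.Nat.sum_antidiagonal_swap]
  dsimp only [Prod.snd_swap]
  rw [Finset.Nat.sum_antidiagonal_eq_sum_range_succ (fun i _ ↦ 1 / hx i)]
  ring

lemma c_diag (s : ℕ) :
    ∑ p ∈ Finset.HasAntidiagonal.antidiagonal s, c p = 1 / hx (s + 1) ^ 2 * Hb (s + 1) := by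
  have h1 : ∀ p ∈ Finset.HasAntidiagonal.antidiagonal s, c p =
      1 / hx (s + 1) ^ 2 * ((-1) ^ p.1 / ((p.1 : ℝ) + 1)) := by
    intro p hp
    rw [Finset.HasAntidiagonal.mem_antidiagonal] at hp
    have e : hx (s + 1) = hx p.2 + ((p.1 : ℝ) + 1) := by
      rw [← hx_shift, ← hp, add_assoc]
    have := hx_pos p.2
    unfold c
    rw [e]
    field_simp
  rw [Finset.sum_congr rfl h1, ← Finset.mul_sum,
    Finset.Nat.sum_antidiagonal_eq_sum_range_succ (fun i _ ↦ (-1 : ℝ) ^ i / ((i : ℝ) + 1))]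
  rfl

lemma fc_diag (s : ℕ) :
    ∑ p ∈ Finset.HasAntidiagonal.antidiagonal s, (f p + c p) =
      (-1) ^ (s + 1) * altOddH 1 (s + 1) / hx (s + 1) ^ 2 := by
  have h1 : ∀ p ∈ Finset.HasAntidiagonal.antidiagonal s, f p + c p =
      (-1) ^ (s + 1) / hx (s + 1) ^ 2 * ((-1) ^ p.2 / hx p.2) := by
    intro p hp
    rw [Finset.HasAntidiagonal.mem_antidiagonal] at hp
    have e : hx (s + 1) = hx p.2 + ((p.1 : ℝ) + 1) := by
      rw [← hx_shift, ← hp, add_assoc]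
    have := hx_pos p.2
    have h3 : (-1 : ℝ) ^ p.2 * (-1) ^ p.2 = 1 := by rw [← mul_pow]; simp
    have h4 : (-1 : ℝ) ^ (s + 1) / hx (s + 1) ^ 2 * ((-1) ^ p.2 / hx p.2) =
        -(-1) ^ p.1 / (hx (s + 1) ^ 2 * hx p.2) := by
      rw [div_mul_div_comm]
      congr 1
      rw [← hp, pow_succ, pow_add]
      linear_combination (-(-1 : ℝ) ^ p.1) * h3
    rw [h4]
    unfold c f
    rw [e, pow_succ]
    field_simp
    ring
  rw [Finset.sum_congr rfl h1, ← Finset.mul_sum, ← Finset.Nat.sum_antidiagonal_swap]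
  dsimp only [Prod.snd_swap]
  rw [Finset.Nat.sum_antidiagonal_eq_sum_range_succ (fun i _ ↦ (-1 : ℝ) ^ i / hx i),
    ← altOddH_eq]
  ring

lemma zeta_three : HasSum (fun n : ℕ ↦ 1 / (n : ℝ) ^ 3) (zetaR 3) := by
  have h : Summable (fun n : ℕ ↦ 1 / (n : ℝ) ^ 3) :=
    Real.summable_one_div_nat_pow.2 (by norm_num)
  have h2 := h.hasSum
  rw [h.tsum_eq_zero_add] at h2
  have e : zetaR 3 = 1 / ((0 : ℕ) : ℝ) ^ 3 + ∑' n : ℕ, 1 / ((n + 1 : ℕ) : ℝ) ^ 3 := by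
    unfold zetaR
    push_cast
    norm_num
  rw [e]
  exact h2

lemma hs_congr {u v : ℕ → ℝ} {a : ℝ} (h : ∀ k, u k = v k) : HasSum u a ↔ HasSum v a := by
  rw [funext h]

lemma main : HasSum (fun n : ℕ ↦ (-1 : ℝ) ^ n * altOddH 1 n / hx n ^ 2)
    (Real.pi ^ 2 / 2 * Real.log 2 - 7 / 2 * zetaR 3) := by
  obtain ⟨P, hP⟩ := exists_P
  have ht := hasSum_hx_pow hasSum_zeta_two
  have ht3 := hasSum_hx_pow zeta_three
  have hQ : Summable (fun k ↦ (-1 : ℝ) ^ k / hx k ^ 2) := by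
    refine Summable.of_norm_bounded ht.summable fun k ↦ ?_
    have := hx_pos k
    rw [norm_div, norm_pow, norm_neg, norm_one, one_pow, Real.norm_of_nonneg (by positivity)]
  obtain ⟨Q, hQ⟩ := hQ
  obtain ⟨A, hA⟩ := summable_f
  obtain ⟨C, hC⟩ := summable_c
  -- 2A as the sum of g
  have hA1 := hA.prod_fiberwise f_row
  have hg := antidiag summable_g.hasSum
  simp_rw [g_diag] at hg
  have hgA := hg.unique (hA1.mul_left 2)
  have hG : HasSum g (2 * A) := hgA ▸ summable_g.hasSum
  have hG1 := (swap_hasSum hG).prod_fiberwise (g_col hP)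
  have hA2 := (swap_hasSum hA).prod_fiberwise (f_col hP)
  -- the sum C
  have hC1 := antidiag hC
  simp_rw [c_diag] at hC1
  have hC2 := (hasSum_nat_add_iff (f := fun k ↦ 1 / hx k ^ 2 * Hb k) 1).1 hC1
  have hS1 := antidiag (hA.add hC)
  simp_rw [fc_diag] at hS1
  have hS2 := (hasSum_nat_add_iff
    (f := fun n : ℕ ↦ (-1 : ℝ) ^ n * altOddH 1 n / hx n ^ 2) 1).1 hS1
  have z1 : Hb 0 = 0 := by simp [Hb]
  have z2 : altOddH 1 0 = 0 := by simp [altOddH]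
  simp only [Finset.range_one, Finset.sum_singleton, z1, z2,
    mul_zero, zero_div, add_zero] at hC2 hS2
  have q1 := ((ht.mul_left (Real.log 2)).sub hC2).sub (hQ.mul_left P)
  have q2 := ((ht.mul_left (-Real.log 2)).sub (hQ.mul_left P)).add (hS2.add ht3)
  have r1 : 2 * A = Real.log 2 * ((2 ^ 2 - 1) * (Real.pi ^ 2 / 6)) - C - P * Q := by
    refine hG1.unique ((hs_congr fun k ↦ ?_).1 q1)
    ring
  have r2 : A = -Real.log 2 * ((2 ^ 2 - 1) * (Real.pi ^ 2 / 6)) - P * Q +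
      (A + C + (2 ^ 3 - 1) * zetaR 3) := by
    refine hA2.unique ((hs_congr fun k ↦ ?_).1 q2)
    have h3 : (-1 : ℝ) ^ k * (-1) ^ k = 1 := by rw [← mul_pow]; simp
    have e : altOddH 1 (k + 1) = altOddH 1 k + (-1) ^ k / hx k := by
      rw [altOddH_eq, altOddH_eq, Finset.sum_range_succ]
    have := hx_pos k
    rw [e]
    field_simp
    linear_combination (-1 : ℝ) * h3
  have e : A + C = Real.pi ^ 2 / 2 * Real.log 2 - 7 / 2 * zetaR 3 := by linarith
  rw [← e]
  exact hS2

end AltT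

/-- ∑_{n=1}^∞ (−1)^{n−1} h̄_{n−1}/(n−1/2)² = (π²/2)·log 2 − (7/2)ζ(3) -/
theorem alt_alt_linear_T_sum_12 :
    (∑' n : ℕ, (-1 : ℝ) ^ n * altOddH 1 n / ((n : ℝ) + 1 / 2) ^ 2) =
      Real.pi ^ 2 / 2 * Real.log 2 - 7 / 2 * zetaR 3 := by
  exact AltT.main.tsum_eq
end

section
/- Let p ≥ 1 and q ≥ 2 be integers with p + q odd. Then 2·∑_{n=1}^∞ h_{n-1}^{(p)}/(n-1/2)^q = (-1)^{p+q}·t̃(p+q) - (-1)^p·(1+(-1)^q)·t̃(p)·t̃(q) - (-1)^p·∑_{k=0}^{p-1} ((-1)^k - 1)·C(p+q-k-2, q-1)·t̃(k+1)·ζ(p+q-k-1) + (-1)^p·∑_{k=1}^{q} (1-(-1)^{q-k})·C(k+p-2, p-1)·t̃(q-k+1)·ζ(k+p-1), where t̃(j) := (2^j - 1)·ζ(j) for j ≥ 2, t̃(1) := 2·log 2, and ζ(1) := 0 by convention. -/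
open scoped BigOperators

/-- ζ(p) = ∑_{n=1}^∞ 1/n^p, with the convention ζ(1) := 0. -/
noncomputable def zetaC (p : ℕ) : ℝ :=
  if p = 1 then 0 else ∑' n : ℕ, 1 / ((n : ℝ) + 1) ^ p

/-- t̃(j) = ∑_{k=1}^∞ 1/(k−1/2)^j for j ≥ 2, with t̃(1) := 2·log 2. -/
noncomputable def ttil (j : ℕ) : ℝ :=
  if j = 1 then 2 * Real.log 2 else ∑' k : ℕ, 1 / ((k : ℝ) + 1 / 2) ^ j

/-- ζ̄(j) = ∑_{k=1}^∞ (−1)^{k−1}/k^j -/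
noncomputable def zbar (j : ℕ) : ℝ := ∑' k : ℕ, (-1 : ℝ) ^ k / ((k : ℝ) + 1) ^ j

/-- t̄(j) = ∑_{k=1}^∞ (−1)^{k−1}/(k−1/2)^j -/
noncomputable def tbar (j : ℕ) : ℝ := ∑' k : ℕ, (-1 : ℝ) ^ k / ((k : ℝ) + 1 / 2) ^ j

theorem hasSum_congr_aux {f g : ℕ → ℝ} {a : ℝ} (h : ∀ n, f n = g n) : HasSum f a ↔ HasSum g a := by
  rw [funext h]


theorem pfA (u v w : ℝ) (h : u * v = w * (u + v)) : ∀ p q : ℕ,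
    u ^ (p + 1) * v ^ (q + 1) =
      ∑ j ∈ Finset.range (p + 1), ((j + q).choose q : ℝ) * w ^ (j + q + 1) * u ^ (p + 1 - j)
      + ∑ j ∈ Finset.range (q + 1), ((j + p).choose p : ℝ) * w ^ (j + p + 1) * v ^ (q + 1 - j) := by
  have key : ∀ (a b : ℝ) (p q : ℕ),
      ∑ j ∈ Finset.range (p + 2), ((j + (q + 1)).choose (q + 1) : ℝ) * w ^ (j + (q + 1) + 1) * a ^ (p + 2 - j)
      = w * (∑ j ∈ Finset.range (p + 1), ((j + (q + 1)).choose (q + 1) : ℝ) * w ^ (j + (q + 1) + 1) * a ^ (p + 1 - j)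
        + ∑ j ∈ Finset.range (p + 2), ((j + q).choose q : ℝ) * w ^ (j + q + 1) * a ^ (p + 2 - j)) := by
    intro a b p q
    rw [Finset.sum_range_succ', Finset.sum_range_succ' (n := p + 1) (f := fun j => ((j + q).choose q : ℝ) * w ^ (j + q + 1) * a ^ (p + 2 - j))]
    rw [← add_assoc (Finset.sum _ _) (Finset.sum _ _), ← Finset.sum_add_distrib, mul_add, Finset.mul_sum]
    congr 1
    · apply Finset.sum_congr rfl
      intro j hj
      have e1 : p + 2 - (j + 1) = p + 1 - j := by omega
      have e2 : (j + 1 + (q + 1)).choose (q + 1) = (j + 1 + q).choose q + (j + (q + 1)).choose (q + 1) := by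
        have : j + 1 + (q + 1) = (j + 1 + q) + 1 := by ring
        rw [this, Nat.choose_succ_succ]
        congr 2
        ring
      rw [e1, e2]
      push_cast
      ring
    · simp
      ring
  have zero : ∀ (a : ℝ) (p : ℕ), ∑ j ∈ Finset.range (p + 2), ((j + 0).choose 0 : ℝ) * w ^ (j + 0 + 1) * a ^ (p + 2 - j)
      = w * (a ^ (p + 2) + ∑ j ∈ Finset.range (p + 1), ((j + 0).choose 0 : ℝ) * w ^ (j + 0 + 1) * a ^ (p + 1 - j)) := by
    intro a p
    rw [Finset.sum_range_succ', mul_add, Finset.mul_sum, add_comm]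
    congr 1
    · simp
    · apply Finset.sum_congr rfl
      intro j hj
      have e1 : p + 2 - (j + 1) = p + 1 - j := by omega
      rw [e1]
      simp
      ring
  intro p
  induction p with
  | zero =>
    intro q
    induction q with
    | zero => simp; linarith
    | succ q ih =>
      have e : u ^ (0 + 1) * v ^ (q + 1 + 1) = w * (u ^ (0 + 1) * v ^ (q + 1) + v ^ (q + 2)) := by
        linear_combination v ^ (q + 1) * h
      rw [e, ih]
      have := zero v q
      rw [this]
      simp
      ring
  | succ p ihp =>
    intro q
    induction q with
    | zero =>
      have e : u ^ (p + 1 + 1) * v ^ (0 + 1) = w * (u ^ (p + 1) * v ^ (0 + 1) + u ^ (p + 2)) := by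
        linear_combination u ^ (p + 1) * h
      rw [e, ihp 0, zero u p]
      simp
      ring
    | succ q ih =>
      have e : u ^ (p + 1 + 1) * v ^ (q + 1 + 1)
          = w * (u ^ (p + 1) * v ^ (q + 1 + 1) + u ^ (p + 1 + 1) * v ^ (q + 1)) := by
        linear_combination u ^ (p + 1) * v ^ (q + 1) * h
      rw [e, ihp (q + 1), ih, key u v p q, key v u q p]
      ring

/-- partial fractions for `x + y = n`. -/
theorem pfB (x y n : ℝ) (hx : x ≠ 0) (hy : y ≠ 0) (hn : n ≠ 0) (h : x + y = n) (p q : ℕ)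
    (hp : 1 ≤ p) (hq : 1 ≤ q) :
    1 / (x ^ p * y ^ q) =
      ∑ j ∈ Finset.range p, ((j + (q - 1)).choose (q - 1) : ℝ) * (1 / n ^ (j + q)) * (1 / x ^ (p - j))
      + ∑ j ∈ Finset.range q, ((j + (p - 1)).choose (p - 1) : ℝ) * (1 / n ^ (j + p)) * (1 / y ^ (q - j)) := by
  obtain ⟨p, rfl⟩ : ∃ r, p = r + 1 := ⟨p - 1, by omega⟩
  obtain ⟨q, rfl⟩ : ∃ r, q = r + 1 := ⟨q - 1, by omega⟩
  have := pfA (1 / x) (1 / y) (1 / n) (by field_simp; linarith) p q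
  simp only [one_div_pow] at this
  simp only [Nat.add_sub_cancel, ← add_assoc]
  rw [← this]
  field_simp

theorem oddH_mono (p : ℕ) : Monotone (oddH p) := by
  apply monotone_nat_of_le_succ
  intro n
  unfold oddH
  rw [Finset.sum_range_succ]
  have : 0 ≤ 1 / ((n : ℝ) + 1 / 2) ^ p := by positivity
  linarith

theorem oddH_add (p a b : ℕ) :
    oddH p (a + b) = oddH p a + ∑ i ∈ Finset.range b, 1 / ((a : ℝ) + i + 1 / 2) ^ p := by
  unfold oddH
  rw [Finset.sum_range_add]
  push_cast
  rfl

theorem oddH_nonneg (p n : ℕ) : 0 ≤ oddH p n := by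
  unfold oddH; positivity

theorem oddH_subadd (p a b : ℕ) : oddH p (a + b) ≤ oddH p a + oddH p b := by
  rw [oddH_add]
  gcongr
  unfold oddH
  apply Finset.sum_le_sum
  intro i hi
  apply one_div_le_one_div_of_le
  · positivity
  · gcongr
    have : (0:ℝ) ≤ a := by positivity
    linarith

theorem oddH_shift (p r : ℕ) (hp : 1 ≤ p) :
    Filter.Tendsto (fun N => oddH p (N + r) - oddH p N) Filter.atTop (nhds 0) := by
  have : (fun N => oddH p (N + r) - oddH p N)
      = fun N : ℕ => ∑ i ∈ Finset.range r, 1 / ((N : ℝ) + i + 1 / 2) ^ p := by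
    funext N; rw [oddH_add]; ring
  rw [this]
  have h0 : (0:ℝ) = ∑ i ∈ Finset.range r, 0 := by simp
  rw [h0]
  apply tendsto_finsetSum
  intro i _
  simp only [one_div]
  apply Filter.Tendsto.inv_tendsto_atTop
  apply (Filter.tendsto_pow_atTop (by omega)).comp
  simp only [add_assoc]
  exact Filter.tendsto_atTop_add_const_right _ _ tendsto_natCast_atTop_atTop

theorem summable_half (k : ℕ) (hk : 2 ≤ k) : Summable (fun m : ℕ => 1 / ((m : ℝ) + 1 / 2) ^ k) := by
  have h1 : Summable (fun m : ℕ => 1 / ((m : ℝ)) ^ k) := Real.summable_one_div_nat_pow.2 (by omega)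
  have h2 := ((summable_nat_add_iff 1).2 h1).mul_left (2 ^ k)
  refine Summable.of_nonneg_of_le (fun m => by positivity) (fun m => ?_) h2
  rw [mul_one_div, div_le_div_iff₀ (by positivity) (by positivity), one_mul, ← mul_pow]
  gcongr
  push_cast
  linarith [(Nat.cast_nonneg m : (0:ℝ) ≤ m)]

theorem tendsto_half (k : ℕ) (hk : 2 ≤ k) :
    Filter.Tendsto (oddH k) Filter.atTop (nhds (ttil k)) := by
  have := (summable_half k hk).hasSum.tendsto_sum_nat
  rw [ttil, if_neg (by omega)]
  exact this

/-- correction -/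
noncomputable def cc (p N : ℕ) : ℝ := if p = 1 then ∑ i ∈ Finset.range N, 1 / ((i : ℝ) + 1) else 0

theorem oddH_one (N : ℕ) : oddH 1 N - cc 1 N = 2 * ((harmonic (2 * N) : ℚ) : ℝ) - 2 * ((harmonic N : ℚ) : ℝ) := by
  induction N with
  | zero => simp [oddH, cc]
  | succ N ih =>
    simp only [oddH, cc, if_true, Finset.sum_range_succ, mul_add, mul_one, harmonic_succ, pow_one] at ih ⊢
    push_cast
    rw [add_sub_add_comm, ih]
    field_simp
    ring

theorem tendsto_cc (p : ℕ) (hp : 1 ≤ p) :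
    Filter.Tendsto (fun N => oddH p N - cc p N) Filter.atTop (nhds (ttil p)) := by
  rcases Nat.lt_or_ge 1 p with h | h
  · have := tendsto_half p h
    have e : ∀ N, cc p N = 0 := fun N => by rw [cc, if_neg (by omega)]
    simpa [e] using this
  · obtain rfl : p = 1 := by omega
    simp only [oddH_one, ttil, if_true]
    have h1 := Real.tendsto_harmonic_sub_log
    have h2 := h1.comp (Filter.tendsto_id.const_mul_atTop' (show 0 < 2 by norm_num))
    have h3 := ((h2.sub h1).add_const (Real.log 2)).const_mul 2
    simp only [sub_self, zero_add] at h3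
    refine h3.congr' ?_
    filter_upwards [Filter.eventually_gt_atTop 0] with N hN
    have : (N:ℝ) ≠ 0 := by positivity
    simp only [Function.comp, id]
    push_cast
    rw [Real.log_mul (by norm_num) this]
    ring

theorem tendsto_zeta (j : ℕ) (hj : 1 ≤ j) :
    Filter.Tendsto (fun N => ∑ i ∈ Finset.range N, 1 / ((i : ℝ) + 1) ^ j - cc j N) Filter.atTop (nhds (zetaC j)) := by
  rcases Nat.lt_or_ge 1 j with h | h
  · have e : ∀ N, cc j N = 0 := fun N => by rw [cc, if_neg (by omega)]
    have h1 : Summable (fun m : ℕ => 1 / ((m : ℝ)) ^ j) := Real.summable_one_div_nat_pow.2 (by omega)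
    have h2 := ((summable_nat_add_iff 1).2 h1)
    push_cast at h2
    rw [zetaC, if_neg (by omega)]
    simpa [e] using h2.hasSum.tendsto_sum_nat
  · obtain rfl : j = 1 := by omega
    simp [cc, zetaC]

theorem negh (A b : ℝ) (q : ℕ) : 1 / (A * (-b) ^ q) = (-1) ^ q * (1 / (A * b ^ q)) := by
  rw [neg_pow b]
  rcases neg_one_pow_eq_or ℝ q with h | h <;> rw [h] <;> simp

theorem sum_split (n M : ℕ) (g : ℝ → ℝ) :
    ∑ i ∈ Finset.range (M + (n + M)), g ((i : ℝ) - M + 1 / 2)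
      = ∑ m ∈ Finset.range M, g (-((m : ℝ) + 1 / 2)) + ∑ m ∈ Finset.range n, g ((m : ℝ) + 1 / 2)
        + ∑ m ∈ Finset.range M, g ((n : ℝ) + ((m : ℝ) + 1 / 2)) := by
  rw [Finset.sum_range_add, Finset.sum_range_add, ← Finset.sum_range_reflect, ← add_assoc]
  congr 1
  · congr 1
    · apply Finset.sum_congr rfl
      intro m hm
      have hm := Finset.mem_range.1 hm
      congr 1
      have : M - 1 - m = M - (m + 1) := by omega
      rw [this, Nat.cast_sub (by omega)]
      push_cast
      ring
    · apply Finset.sum_congr rfl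
      intro m hm
      congr 1
      push_cast
      ring
  · apply Finset.sum_congr rfl
    intro m hm
    congr 1
    push_cast
    ring

theorem sum_refl (n M : ℕ) (g : ℝ → ℝ) :
    ∑ i ∈ Finset.range (M + (n + M)), g ((n : ℝ) - ((i : ℝ) - M + 1 / 2))
      = ∑ i ∈ Finset.range (M + (n + M)), g ((i : ℝ) - M + 1 / 2) := by
  rw [← Finset.sum_range_reflect]
  apply Finset.sum_congr rfl
  intro m hm
  have hm := Finset.mem_range.1 hm
  congr 1
  have : M + (n + M) - 1 - m = M + (n + M) - (m + 1) := by omega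
  rw [this, Nat.cast_sub (by omega)]
  push_cast
  ring

theorem tendsto_U_s11 (n k : ℕ) (hk : 1 ≤ k) :
    Filter.Tendsto (fun M : ℕ => ∑ i ∈ Finset.range (M + (n + M)), 1 / ((i : ℝ) - M + 1 / 2) ^ k)
      Filter.atTop (nhds ((1 + (-1) ^ k) * ttil k)) := by
  have e : (fun M : ℕ => ∑ i ∈ Finset.range (M + (n + M)), 1 / ((i : ℝ) - M + 1 / 2) ^ k)
      = fun M => (1 + (-1) ^ k) * oddH k M + (oddH k (M + n) - oddH k M) := by
    funext M
    rw [sum_split n M (fun x => 1 / x ^ k)]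
    have e1 : ∑ m ∈ Finset.range M, 1 / (-((m : ℝ) + 1 / 2)) ^ k = (-1) ^ k * oddH k M := by
      unfold oddH
      rw [Finset.mul_sum]
      apply Finset.sum_congr rfl
      intro m _
      rw [neg_pow]
      rcases neg_one_pow_eq_or ℝ k with h | h <;> rw [h] <;> simp [inv_neg]
    have e2 : oddH k (M + n) = ∑ m ∈ Finset.range n, 1 / ((m : ℝ) + 1 / 2) ^ k
        + ∑ m ∈ Finset.range M, 1 / ((n : ℝ) + ((m : ℝ) + 1 / 2)) ^ k := by
      rw [add_comm M n, oddH_add]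
      simp only [add_assoc]
      rfl
    rw [e1, e2]
    ring
  rw [e]
  have h2 := oddH_shift k n hk
  have h1 : Filter.Tendsto (fun M => (1 + (-1 : ℝ) ^ k) * oddH k M) Filter.atTop
      (nhds ((1 + (-1) ^ k) * ttil k)) := by
    rcases Nat.lt_or_ge 1 k with h | h
    · exact (tendsto_half k h).const_mul _
    · obtain rfl : k = 1 := by omega
      simp
  simpa using h1.add h2

noncomputable def FF (p q n : ℕ) : ℝ :=
  ∑ m ∈ Finset.range n, 1 / (((n : ℝ) - ((m : ℝ) + 1 / 2)) ^ p * ((m : ℝ) + 1 / 2) ^ q)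

noncomputable def GG (p q n : ℕ) : ℝ :=
  ∑' m : ℕ, 1 / (((n : ℝ) + ((m : ℝ) + 1 / 2)) ^ p * ((m : ℝ) + 1 / 2) ^ q)

theorem summable_GG (p q n : ℕ) (hpq : 2 ≤ p + q) :
    Summable (fun m : ℕ => 1 / (((n : ℝ) + ((m : ℝ) + 1 / 2)) ^ p * ((m : ℝ) + 1 / 2) ^ q)) := by
  refine Summable.of_nonneg_of_le (fun m => by positivity) (fun m => ?_) (summable_half (p + q) hpq)
  apply one_div_le_one_div_of_le (by positivity)
  rw [pow_add]
  have h0 : (m : ℝ) + 1 / 2 ≤ (n : ℝ) + ((m : ℝ) + 1 / 2) := by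
    linarith [(Nat.cast_nonneg n : (0:ℝ) ≤ n)]
  gcongr

theorem half_ne (m M : ℕ) : (m : ℝ) - M + 1 / 2 ≠ 0 := by
  intro h
  have : ((2 * m + 1 : ℕ) : ℝ) = (2 * M : ℕ) := by push_cast; linarith
  have := Nat.cast_injective this
  omega

theorem half_ne' (n m M : ℕ) : (n : ℝ) - ((m : ℝ) - M + 1 / 2) ≠ 0 := by
  intro h
  have : ((2 * m + 1 : ℕ) : ℝ) = (2 * M + 2 * n : ℕ) := by push_cast; linarith
  have := Nat.cast_injective this
  omega

theorem inner_eval (p q n : ℕ) (hp : 1 ≤ p) (hq : 1 ≤ q) (hn : 1 ≤ n) :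
    FF p q n + (-1) ^ q * GG p q n + (-1) ^ p * GG q p n =
      ∑ j ∈ Finset.range p, ((j + (q - 1)).choose (q - 1) : ℝ) * (1 / (n : ℝ) ^ (j + q)) *
        ((1 + (-1) ^ (p - j)) * ttil (p - j))
      + ∑ j ∈ Finset.range q, ((j + (p - 1)).choose (p - 1) : ℝ) * (1 / (n : ℝ) ^ (j + p)) *
        ((1 + (-1) ^ (q - j)) * ttil (q - j)) := by
  have hn0 : (n : ℝ) ≠ 0 := by positivity
  set g : ℝ → ℝ := fun a => 1 / (((n : ℝ) - a) ^ p * a ^ q) with hg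
  have h1 : Filter.Tendsto (fun M : ℕ => ∑ i ∈ Finset.range (M + (n + M)), g ((i : ℝ) - M + 1 / 2))
      Filter.atTop (nhds (FF p q n + (-1) ^ q * GG p q n + (-1) ^ p * GG q p n)) := by
    have hG := (summable_GG p q n (by omega)).hasSum.tendsto_sum_nat.const_mul ((-1 : ℝ) ^ q)
    have hH := (summable_GG q p n (by omega)).hasSum.tendsto_sum_nat.const_mul ((-1 : ℝ) ^ p)
    refine ((hG.const_add (FF p q n)).add hH).congr ?_
    intro M
    rw [sum_split n M g, add_comm (∑ m ∈ Finset.range M, g (-((m : ℝ) + 1 / 2)))]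
    congr 1
    · congr 1
      rw [Finset.mul_sum]
      apply Finset.sum_congr rfl
      intro m _
      simp only [hg]
      rw [negh, sub_neg_eq_add]
    · rw [Finset.mul_sum]
      apply Finset.sum_congr rfl
      intro m _
      simp only [hg]
      rw [sub_add_cancel_left, mul_comm ((-((m : ℝ) + 1 / 2)) ^ p), negh]
  refine tendsto_nhds_unique h1 ?_
  have e : ∀ M : ℕ, ∑ i ∈ Finset.range (M + (n + M)), g ((i : ℝ) - M + 1 / 2) =
      ∑ j ∈ Finset.range p, ((j + (q - 1)).choose (q - 1) : ℝ) * (1 / (n : ℝ) ^ (j + q)) *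
        (∑ i ∈ Finset.range (M + (n + M)), 1 / ((i : ℝ) - M + 1 / 2) ^ (p - j))
      + ∑ j ∈ Finset.range q, ((j + (p - 1)).choose (p - 1) : ℝ) * (1 / (n : ℝ) ^ (j + p)) *
        (∑ i ∈ Finset.range (M + (n + M)), 1 / ((i : ℝ) - M + 1 / 2) ^ (q - j)) := by
    intro M
    have : ∀ i ∈ Finset.range (M + (n + M)), g ((i : ℝ) - M + 1 / 2) = _ := fun i _ =>
      pfB (n - ((i : ℝ) - M + 1 / 2)) ((i : ℝ) - M + 1 / 2) n (half_ne' _ _ _) (half_ne _ _) hn0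
        (by ring) p q hp hq
    rw [Finset.sum_congr rfl this, Finset.sum_add_distrib, Finset.sum_comm]
    congr 1
    · apply Finset.sum_congr rfl
      intro j _
      rw [← Finset.mul_sum, sum_refl n M (fun x => 1 / x ^ (p - j))]
    · rw [Finset.sum_comm]
      apply Finset.sum_congr rfl
      intro j _
      rw [← Finset.mul_sum]
  simp only [e]
  apply Filter.Tendsto.add
  · apply tendsto_finsetSum
    intro j hj
    have := Finset.mem_range.1 hj
    exact (tendsto_U_s11 n (p - j) (by omega)).const_mul _
  · apply tendsto_finsetSum
    intro j hj
    have := Finset.mem_range.1 hj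
    exact (tendsto_U_s11 n (q - j) (by omega)).const_mul _

theorem summable_f : Summable (fun n : ℕ => 1 / (((n : ℝ) + 1) * √((n : ℝ) + 1))) := by
  have h := (summable_nat_add_iff 1).2 (Real.summable_one_div_nat_rpow.2 (show (1:ℝ) < 3 / 2 by norm_num))
  refine h.congr ?_
  intro n
  push_cast
  rw [show (3 / 2 : ℝ) = 1 + 1 / 2 by norm_num, Real.rpow_add (by positivity), Real.rpow_one,
    Real.sqrt_eq_rpow]

theorem summable_P (p q : ℕ) (hp : 1 ≤ p) (hq : 2 ≤ q) :
    Summable (fun x : ℕ × ℕ => 1 / ((((x.2 + 1 : ℕ) : ℝ) + ((x.1 : ℝ) + 1 / 2)) ^ q * ((x.1 : ℝ) + 1 / 2) ^ p)) := by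
  have h := (summable_f.mul_of_nonneg summable_f (fun n => by positivity) (fun n => by positivity)).mul_left (4 * 2 ^ p)
  refine Summable.of_nonneg_of_le (fun m => by positivity) ?_ h
  rintro ⟨m, i⟩
  simp only
  push_cast
  set x : ℝ := (m : ℝ) + 1 with hx
  set y : ℝ := (i : ℝ) + 1 with hy
  have hx1 : 1 ≤ x := by rw [hx]; linarith [(Nat.cast_nonneg m : (0:ℝ) ≤ m)]
  have hy1 : 1 ≤ y := by rw [hy]; linarith [(Nat.cast_nonneg i : (0:ℝ) ≤ i)]
  have hb : (m : ℝ) + 1 / 2 = x - 1 / 2 := by rw [hx]; ring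
  rw [hb, one_div_mul_one_div, mul_one_div, div_le_div_iff₀ (by
    have : 0 < x - 1 / 2 := by linarith
    positivity) (by positivity), one_mul]
  have h1 : x ≤ 2 ^ p * (x - 1 / 2) ^ p := by
    rw [← mul_pow]
    calc x ≤ 2 * (x - 1 / 2) := by linarith
      _ = (2 * (x - 1 / 2)) ^ 1 := by ring
      _ ≤ _ := pow_le_pow_right₀ (by linarith) hp
  have h2 : (x + y) ^ 2 ≤ 4 * (y + (x - 1 / 2)) ^ q := by
    calc (x + y) ^ 2 ≤ 4 * (y + (x - 1 / 2)) ^ 2 := by nlinarith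
      _ ≤ _ := by
        gcongr
        linarith
  have h3 : √x * √y * y ≤ (x + y) ^ 2 := by
    have : √x * √y ≤ x + y := by
      have a := Real.sq_sqrt (show 0 ≤ x by linarith)
      have b := Real.sq_sqrt (show 0 ≤ y by linarith)
      nlinarith [sq_nonneg (√x - √y)]
    calc √x * √y * y ≤ (x + y) * (x + y) := by gcongr; linarith
      _ = _ := by ring
  calc x * √x * (y * √y) = x * (√x * √y * y) := by ring
    _ ≤ (2 ^ p * (x - 1 / 2) ^ p) * (4 * (y + (x - 1 / 2)) ^ q) := by
      exact mul_le_mul h1 (h3.trans h2) (by positivity) (by linarith)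
    _ = _ := by ring

theorem hasSum_S (p q : ℕ) (hp : 1 ≤ p) (hq : 2 ≤ q) :
    Summable (fun n : ℕ => oddH p n / ((n : ℝ) + 1 / 2) ^ q) ∧
    HasSum (fun i => GG q p (i + 1)) (∑' n : ℕ, oddH p n / ((n : ℝ) + 1 / 2) ^ q) := by
  have hP := summable_P p q hp hq
  set P : ℕ × ℕ → ℝ := (fun x : ℕ × ℕ => 1 / ((((x.2 + 1 : ℕ) : ℝ) + ((x.1 : ℝ) + 1 / 2)) ^ q * ((x.1 : ℝ) + 1 / 2) ^ p)) with hPdef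
  have hT := hP.hasSum
  set T := ∑' x, P x
  have h1 : HasSum (fun i => GG q p (i + 1)) T := by
    have h := (Equiv.prodComm ℕ ℕ).hasSum_iff.2 hT
    refine h.prod_fiberwise ?_
    intro i
    exact (summable_GG q p (i + 1) (by omega)).hasSum
  have h2 : HasSum (fun n : ℕ => oddH p n / ((n : ℝ) + 1 / 2) ^ q) T := by
    rw [← hasSum_nat_add_iff' 1]
    have h := (Finset.HasAntidiagonal.sigmaAntidiagonalEquivProd (A := ℕ)).hasSum_iff.2 hT
    have h' := h.sigma (fun n => hasSum_fintype _)
    have e : T - ∑ i ∈ Finset.range 1, oddH p i / ((i : ℝ) + 1 / 2) ^ q = T := by simp [oddH]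
    rw [e]
    refine (hasSum_congr_aux fun n => ?_).mpr h'
    change _ = ∑ b : Finset.HasAntidiagonal.antidiagonal n, P b
    rw [Finset.univ_eq_attach]
    rw [Finset.sum_attach (Finset.HasAntidiagonal.antidiagonal n) (fun x => P x)]
    rw [Finset.Nat.sum_antidiagonal_eq_sum_range_succ_mk]
    unfold oddH
    rw [Finset.sum_div]
    apply Finset.sum_congr rfl
    intro m hm
    have hm := Finset.mem_range.1 hm
    simp only [hPdef]
    rw [Nat.cast_add (n - m), Nat.cast_sub (by omega), div_div, mul_comm]
    congr 3
    push_cast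
    ring
  exact ⟨h2.summable, h2.tsum_eq.symm ▸ h1⟩

theorem sum_F (p m N : ℕ) :
    ∑ i ∈ Finset.range N, (if m ≤ i then 1 / (((i + 1 : ℕ) : ℝ) - ((m : ℝ) + 1 / 2)) ^ p else 0)
      = oddH p (N - m) := by
  induction N with
  | zero => simp [oddH]
  | succ N ih =>
    rw [Finset.sum_range_succ, ih]
    split_ifs with h
    · have : N + 1 - m = (N - m) + 1 := by omega
      rw [this]
      unfold oddH
      rw [Finset.sum_range_succ, Nat.cast_sub h]
      congr 3
      push_cast
      ring
    · have h1 : N + 1 - m = 0 := by omega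
      have h2 : N - m = 0 := by omega
      rw [h1, h2, add_zero]

theorem sum_G (p m N : ℕ) :
    ∑ i ∈ Finset.range N, 1 / (((i + 1 : ℕ) : ℝ) + ((m : ℝ) + 1 / 2)) ^ p
      = oddH p (N + (m + 1)) - oddH p (m + 1) := by
  rw [add_comm N, oddH_add, add_sub_cancel_left]
  apply Finset.sum_congr rfl
  intro i _
  congr 2
  push_cast
  ring

theorem hasSum_F (p q i : ℕ) :
    HasSum (fun m : ℕ => 1 / ((m : ℝ) + 1 / 2) ^ q *
      (if m ≤ i then 1 / (((i + 1 : ℕ) : ℝ) - ((m : ℝ) + 1 / 2)) ^ p else 0)) (FF p q (i + 1)) := by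
  have : FF p q (i + 1) = ∑ m ∈ Finset.range (i + 1), 1 / ((m : ℝ) + 1 / 2) ^ q *
      (if m ≤ i then 1 / (((i + 1 : ℕ) : ℝ) - ((m : ℝ) + 1 / 2)) ^ p else 0) := by
    apply Finset.sum_congr rfl
    intro m hm
    have hm := Finset.mem_range.1 hm
    rw [if_pos (by omega), one_div_mul_one_div, mul_comm]
  rw [this]
  apply hasSum_sum_of_ne_finset_zero
  intro m hm
  have hm : ¬ m < i + 1 := fun h => hm (Finset.mem_range.2 h)
  rw [if_neg (by omega), mul_zero]

theorem hasSum_FG (p q N : ℕ) (hq : 2 ≤ q) :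
    HasSum (fun m : ℕ => 1 / ((m : ℝ) + 1 / 2) ^ q *
      ((-1) ^ q * (oddH p (N + (m + 1)) - oddH p (m + 1) - cc p N) + (oddH p (N - m) - cc p N)))
      (∑ i ∈ Finset.range N, (FF p q (i + 1) + (-1) ^ q * GG p q (i + 1))
        - cc p N * ((1 + (-1) ^ q) * ttil q)) := by
  have h1 : ∀ i ∈ Finset.range N, HasSum _ (FF p q (i + 1) + (-1) ^ q * GG p q (i + 1)) := fun i _ =>
    (hasSum_F p q i).add ((summable_GG p q (i + 1) (by omega)).hasSum.mul_left ((-1) ^ q))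
  have h2 := hasSum_sum h1
  have h3 : HasSum (fun m : ℕ => 1 / ((m : ℝ) + 1 / 2) ^ q) (ttil q) := by
    rw [ttil, if_neg (by omega)]
    exact (summable_half q hq).hasSum
  have h4 := h2.sub (h3.mul_left (cc p N * (1 + (-1) ^ q)))
  rw [mul_assoc] at h4
  refine (hasSum_congr_aux fun m => ?_).mpr h4
  rw [Finset.sum_add_distrib, ← Finset.mul_sum, sum_F, ← Finset.mul_sum]
  have : ∑ i ∈ Finset.range N, 1 / ((((i + 1 : ℕ) : ℝ) + ((m : ℝ) + 1 / 2)) ^ p * ((m : ℝ) + 1 / 2) ^ q)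
      = (oddH p (N + (m + 1)) - oddH p (m + 1)) * (1 / ((m : ℝ) + 1 / 2) ^ q) := by
    rw [← sum_G, Finset.sum_mul]
    apply Finset.sum_congr rfl
    intro i _
    rw [one_div_mul_one_div]
  rw [this]
  ring

theorem hasSum_h1 (p q : ℕ) (hp : 1 ≤ p) (hq : 2 ≤ q) :
    HasSum (fun m : ℕ => 1 / ((m : ℝ) + 1 / 2) ^ q * oddH p (m + 1))
      ((∑' n : ℕ, oddH p n / ((n : ℝ) + 1 / 2) ^ q) + ttil (p + q)) := by
  have h1 := (hasSum_S p q hp hq).1.hasSum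
  have h3 : HasSum (fun m : ℕ => 1 / ((m : ℝ) + 1 / 2) ^ (p + q)) (ttil (p + q)) := by
    rw [ttil, if_neg (by omega)]
    exact (summable_half (p + q) (by omega)).hasSum
  refine (hasSum_congr_aux fun m => ?_).mpr (h1.add h3)
  rw [oddH_add p m 1]
  simp
  rw [pow_add]
  field_simp

theorem tendsto_FG (p q : ℕ) (hp : 1 ≤ p) (hq : 2 ≤ q) :
    Filter.Tendsto (fun N => ∑ i ∈ Finset.range N, (FF p q (i + 1) + (-1) ^ q * GG p q (i + 1))
        - cc p N * ((1 + (-1) ^ q) * ttil q)) Filter.atTop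
      (nhds ((1 + (-1) ^ q) * ttil p * ttil q
        - (-1) ^ q * ((∑' n : ℕ, oddH p n / ((n : ℝ) + 1 / 2) ^ q) + ttil (p + q)))) := by
  have hd := tendsto_cc p hp
  obtain ⟨K, hK⟩ := (Metric.isBounded_range_of_tendsto _ hd).exists_norm_le
  have hK : ∀ N, |oddH p N - cc p N| ≤ K := fun N => hK _ ⟨N, rfl⟩
  have hh := hasSum_h1 p q hp hq
  have h3 : HasSum (fun m : ℕ => 1 / ((m : ℝ) + 1 / 2) ^ q) (ttil q) := by
    rw [ttil, if_neg (by omega)]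
    exact (summable_half q hq).hasSum
  have e1 : (fun N => ∑ i ∈ Finset.range N, (FF p q (i + 1) + (-1) ^ q * GG p q (i + 1))
        - cc p N * ((1 + (-1) ^ q) * ttil q)) = fun N => ∑' m : ℕ, 1 / ((m : ℝ) + 1 / 2) ^ q *
      ((-1) ^ q * (oddH p (N + (m + 1)) - oddH p (m + 1) - cc p N) + (oddH p (N - m) - cc p N)) :=
    funext fun N => (hasSum_FG p q N hq).tsum_eq.symm
  have hlim := (h3.mul_left ((1 + (-1) ^ q) * ttil p)).sub (hh.mul_left ((-1) ^ q))
  rw [e1, ← hlim.tsum_eq]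
  have hb : Summable (fun m : ℕ => 1 / ((m : ℝ) + 1 / 2) ^ q * (2 * K + 2 * oddH p (m + 1))) := by
    refine (summable_congr fun m => ?_).mpr ((h3.summable.mul_left (2 * K)).add (hh.summable.mul_left 2))
    ring
  refine tendsto_tsum_of_dominated_convergence hb ?_ ?_
  · intro m
    have t1 : Filter.Tendsto (fun N => oddH p (N + (m + 1)) - cc p N) Filter.atTop (nhds (ttil p)) := by
      have := (oddH_shift p (m + 1) hp).add hd
      simpa using this
    have t2 : Filter.Tendsto (fun N => oddH p (N - m) - cc p N) Filter.atTop (nhds (ttil p)) := by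
      have a : Filter.Tendsto (fun N => oddH p N - oddH p (N - m)) Filter.atTop (nhds 0) := by
        rw [← Filter.tendsto_add_atTop_iff_nat m]
        simpa using oddH_shift p m hp
      have := hd.sub a
      simpa using this
    have := (((t1.sub_const (oddH p (m + 1))).const_mul ((-1 : ℝ) ^ q)).add t2).const_mul
      (1 / ((m : ℝ) + 1 / 2) ^ q)
    convert this using 2
    · ring
    · ring
  · refine Filter.Eventually.of_forall fun N m => ?_
    rw [norm_mul, Real.norm_of_nonneg (show 0 ≤ 1 / ((m : ℝ) + 1 / 2) ^ q by positivity)]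
    apply mul_le_mul_of_nonneg_left _ (by positivity)
    have b1 : |oddH p (N + (m + 1)) - oddH p (m + 1) - cc p N| ≤ K + oddH p (m + 1) := by
      have := abs_le.1 (hK N)
      have a1 := oddH_subadd p N (m + 1)
      have a2 := oddH_mono p (show N ≤ N + (m + 1) by omega)
      have a3 := oddH_nonneg p (m + 1)
      rw [abs_le]
      constructor <;> linarith
    have b2 : |oddH p (N - m) - cc p N| ≤ K + oddH p (m + 1) := by
      have := abs_le.1 (hK N)
      have a1 := oddH_subadd p (N - m) m
      have a2 := oddH_mono p (show N ≤ N - m + m by omega)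
      have a3 := oddH_nonneg p (m + 1)
      have a4 := oddH_mono p (show m ≤ m + 1 by omega)
      have a5 := oddH_mono p (show N - m ≤ N by omega)
      rw [abs_le]
      constructor <;> linarith
    rw [Real.norm_eq_abs]
    refine (abs_add_le _ _).trans ?_
    rw [abs_mul, abs_pow, abs_neg, abs_one, one_pow, one_mul]
    linarith

theorem tendsto_R (p q : ℕ) (hp : 1 ≤ p) (hq : 2 ≤ q) :
    Filter.Tendsto (fun N => ∑ i ∈ Finset.range N,
        (FF p q (i + 1) + (-1) ^ q * GG p q (i + 1) + (-1) ^ p * GG q p (i + 1))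
        - cc p N * ((1 + (-1) ^ q) * ttil q)) Filter.atTop
      (nhds (∑ j ∈ Finset.range p, ((j + (q - 1)).choose (q - 1) : ℝ) * zetaC (j + q) *
        ((1 + (-1) ^ (p - j)) * ttil (p - j))
      + ∑ j ∈ Finset.range q, ((j + (p - 1)).choose (p - 1) : ℝ) * zetaC (j + p) *
        ((1 + (-1) ^ (q - j)) * ttil (q - j)))) := by
  have e : ∀ N, ∑ i ∈ Finset.range N,
        (FF p q (i + 1) + (-1) ^ q * GG p q (i + 1) + (-1) ^ p * GG q p (i + 1))
        - cc p N * ((1 + (-1) ^ q) * ttil q) =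
      ∑ j ∈ Finset.range p, ((j + (q - 1)).choose (q - 1) : ℝ) *
          (∑ i ∈ Finset.range N, 1 / ((i : ℝ) + 1) ^ (j + q) - cc (j + q) N) *
        ((1 + (-1) ^ (p - j)) * ttil (p - j))
      + ∑ j ∈ Finset.range q, ((j + (p - 1)).choose (p - 1) : ℝ) *
          (∑ i ∈ Finset.range N, 1 / ((i : ℝ) + 1) ^ (j + p) - cc (j + p) N) *
        ((1 + (-1) ^ (q - j)) * ttil (q - j)) := by
    intro N
    have c1 : ∀ j, cc (j + q) N = 0 := fun j => by rw [cc, if_neg (by omega)]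
    have c2 : ∑ j ∈ Finset.range q, ((j + (p - 1)).choose (p - 1) : ℝ) * cc (j + p) N *
        ((1 + (-1) ^ (q - j)) * ttil (q - j)) = cc p N * ((1 + (-1) ^ q) * ttil q) := by
      rw [Finset.sum_eq_single 0]
      · simp
      · intro j _ hj
        rw [cc, if_neg (by omega)]
        simp
      · intro h
        exact absurd (Finset.mem_range.2 (by omega)) h
    rw [Finset.sum_congr rfl (fun i _ => inner_eval p q (i + 1) hp (by omega) (by omega)),
      Finset.sum_add_distrib, ← c2, add_sub_assoc]
    congr 1
    · rw [Finset.sum_comm]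
      apply Finset.sum_congr rfl
      intro j _
      rw [← Finset.sum_mul, ← Finset.mul_sum, c1, sub_zero]
      push_cast
      rfl
    · rw [Finset.sum_comm, ← Finset.sum_sub_distrib]
      apply Finset.sum_congr rfl
      intro j _
      rw [← Finset.sum_mul, ← Finset.mul_sum]
      push_cast
      ring
  simp only [e]
  apply Filter.Tendsto.add
  · apply tendsto_finsetSum
    intro j hj
    exact ((tendsto_zeta (j + q) (by omega)).const_mul _).mul_const _
  · apply tendsto_finsetSum
    intro j hj
    exact ((tendsto_zeta (j + p) (by omega)).const_mul _).mul_const _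

theorem alt_formula_4_1 (p q : ℕ) (hp : 1 ≤ p) (hq : 2 ≤ q) (hpq : Odd (p + q)) :
    2 * (∑' n : ℕ, oddH p n / ((n : ℝ) + 1 / 2) ^ q) =
      (-1 : ℝ) ^ (p + q) * ttil (p + q)
      - (-1 : ℝ) ^ p * (1 + (-1 : ℝ) ^ q) * ttil p * ttil q
      - (-1 : ℝ) ^ p * ∑ k ∈ Finset.range p,
          ((-1 : ℝ) ^ k - 1) * (Nat.choose (p + q - k - 2) (q - 1) : ℝ) *
            ttil (k + 1) * zetaC (p + q - k - 1)
      + (-1 : ℝ) ^ p * ∑ k ∈ Finset.Icc 1 q,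
          (1 - (-1 : ℝ) ^ (q - k)) * (Nat.choose (k + p - 2) (p - 1) : ℝ) *
            ttil (q - k + 1) * zetaC (k + p - 1) := by
  have t1 := tendsto_R p q hp hq
  have t2 := (tendsto_FG p q hp hq).add
    ((hasSum_S p q hp hq).2.tendsto_sum_nat.const_mul ((-1 : ℝ) ^ p))
  have key := tendsto_nhds_unique (t1.congr (fun N => by
    rw [Finset.sum_add_distrib, ← Finset.mul_sum]; ring)) t2
  have r1 : ∑ k ∈ Finset.range p,
          ((-1 : ℝ) ^ k - 1) * (Nat.choose (p + q - k - 2) (q - 1) : ℝ) *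
            ttil (k + 1) * zetaC (p + q - k - 1) =
      - ∑ j ∈ Finset.range p, ((j + (q - 1)).choose (q - 1) : ℝ) * zetaC (j + q) *
        ((1 + (-1) ^ (p - j)) * ttil (p - j)) := by
    rw [← Finset.sum_range_reflect, ← Finset.sum_neg_distrib]
    apply Finset.sum_congr rfl
    intro j hj
    have hj := Finset.mem_range.1 hj
    have a1 : p + q - (p - 1 - j) - 2 = j + (q - 1) := by omega
    have a2 : p - 1 - j + 1 = p - j := by omega
    have a3 : p + q - (p - 1 - j) - 1 = j + q := by omega
    have a4 : (-1 : ℝ) ^ (p - j) = - (-1) ^ (p - 1 - j) := by rw [← a2, pow_succ]; ring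
    rw [a1, a2, a3, a4]
    ring
  have r2 : ∑ k ∈ Finset.Icc 1 q,
          (1 - (-1 : ℝ) ^ (q - k)) * (Nat.choose (k + p - 2) (p - 1) : ℝ) *
            ttil (q - k + 1) * zetaC (k + p - 1) =
      ∑ j ∈ Finset.range q, ((j + (p - 1)).choose (p - 1) : ℝ) * zetaC (j + p) *
        ((1 + (-1) ^ (q - j)) * ttil (q - j)) := by
    have : Finset.Icc 1 q = Finset.Ico 1 (q + 1) := by ext; simp
    rw [this, Finset.sum_Ico_eq_sum_range, Nat.add_sub_cancel]
    apply Finset.sum_congr rfl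
    intro j hj
    have hj := Finset.mem_range.1 hj
    have a1 : 1 + j + p - 2 = j + (p - 1) := by omega
    have a2 : q - (1 + j) + 1 = q - j := by omega
    have a3 : 1 + j + p - 1 = j + p := by omega
    have a4 : (-1 : ℝ) ^ (q - j) = - (-1) ^ (q - (1 + j)) := by rw [← a2, pow_succ]; ring
    rw [a1, a2, a3, a4]
    ring
  rw [r1, r2]
  have s0 : (-1 : ℝ) ^ (p + q) = -1 := hpq.neg_one_pow
  have s1 : (-1 : ℝ) ^ p * (-1) ^ q = -1 := by rw [← pow_add]; exact s0
  have s2 : (-1 : ℝ) ^ p * (-1) ^ p = 1 := by rw [← mul_pow]; simp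
  rw [s0]
  generalize (∑' n : ℕ, oddH p n / ((n : ℝ) + 1 / 2) ^ q) = S at *
  linear_combination (-(-1 : ℝ) ^ p) * key - (S) * s2 + (S + ttil (p + q)) * s1
end
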